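/- Let -2 < s < 2 with s ≠ 0. Then there exist positive constants C > c > 0 and an integer N₀ such that for all N ≥ N₀: if -2 < s < 0, then (1/s)·(W_s - c·N^{s/2})/(N-1) ≤ u_s(N) ≤ (1/s)·(W_s - C·N^{s/2})/(N-1); and if 0 < s < 2, then (1/s)·(W_s - C·N^{s/2})/(N-1) ≤ u_s(N) ≤ (1/s)·(W_s - c·N^{s/2})/(N-1). -/

import Mathlib

open scoped BigOperators

/-- The standardized Riesz pair-energy `V_s(r) = (r^{-s} - 1)/s` for `s ≠ 0`,
and `V_0(r) = -log r`. -/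
noncomputable def Vpair (s r : ℝ) : ℝ := if s = 0 then -Real.log r else (r ^ (-s) - 1) / s

/-- The average standardized Riesz pair-energy of an `N`-point configuration on the
unit sphere `S² ⊂ ℝ³`. -/
noncomputable def avgE (s : ℝ) (N : ℕ) (q : Fin N → EuclideanSpace ℝ (Fin 3)) : ℝ :=
  2 / ((N : ℝ) * ((N : ℝ) - 1)) *
    ∑ i : Fin N, ∑ j : Fin N, if i < j then Vpair s ‖q i - q j‖ else 0

/-- The minimal average standardized Riesz pair-energy `v_s(N)`: the infimum of the
average pair-energy over all configurations of `N` pairwise distinct points on `S²`. -/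
noncomputable def vmin (s : ℝ) (N : ℕ) : ℝ :=
  sInf { E : ℝ | ∃ q : Fin N → EuclideanSpace ℝ (Fin 3),
    (∀ i, ‖q i‖ = 1) ∧ Function.Injective q ∧ E = avgE s N q }

/-- `W_s = 2^{1-s}/(2-s)`, the Riesz `s`-energy of the uniform surface measure on `S²`. -/
noncomputable def Wenergy (s : ℝ) : ℝ := (2 : ℝ) ^ (1 - s) / (2 - s)

/-- The minimal average `S²`-adjusted Riesz pair-energy `u_s(N) = v_s(N) - (W_s - 1)/s`. -/
noncomputable def umin (s : ℝ) (N : ℕ) : ℝ := vmin s N - (Wenergy s - 1) / s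

namespace RieszSphere

open MeasureTheory Set ProbabilityTheory

/-- The uniform probability measure on the unit interval. -/
noncomputable def unitMeasure : Measure ℝ := volume.restrict (Ioc 0 1)

/-- The uniform probability measure on the unit square. -/
noncomputable def squareMeasure : Measure (ℝ × ℝ) := unitMeasure.prod unitMeasure

instance : IsProbabilityMeasure unitMeasure := ⟨by simp [unitMeasure]⟩

instance : IsProbabilityMeasure squareMeasure := by
  unfold squareMeasure; infer_instance

theorem integral_unitMeasure (f : ℝ → ℝ) : ∫ a, f a ∂unitMeasure = ∫ a in (0 : ℝ)..1, f a := by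
  rw [intervalIntegral.integral_of_le zero_le_one, unitMeasure]

theorem integrable_unitMeasure_of_continuous {f : ℝ → ℝ} (hf : Continuous f) :
    Integrable f unitMeasure := by
  have := (hf.intervalIntegrable (μ := volume) 0 1).1
  exact this

/-- The equal-area parametrization of the unit sphere by the unit square. -/
noncomputable def sph (p : ℝ × ℝ) : EuclideanSpace ℝ (Fin 3) :=
  !₂[√(4 * p.1 * (1 - p.1)) * Real.cos (2 * Real.pi * p.2),
    √(4 * p.1 * (1 - p.1)) * Real.sin (2 * Real.pi * p.2), 1 - 2 * p.1]

theorem continuous_sph : Continuous sph := by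
  unfold sph
  refine (PiLp.continuous_toLp 2 _).comp (continuous_pi fun i => ?_)
  fin_cases i <;> simp <;> fun_prop

theorem norm_sph {p : ℝ × ℝ} (h0 : 0 ≤ p.1) (h1 : p.1 ≤ 1) : ‖sph p‖ = 1 := by
  have hw : 0 ≤ 4 * p.1 * (1 - p.1) := mul_nonneg (by linarith) (by linarith)
  rw [EuclideanSpace.norm_eq, Real.sqrt_eq_one]
  simp only [sph, Fin.sum_univ_three, Real.norm_eq_abs, sq_abs]
  simp [mul_pow, Real.sq_sqrt hw]
  linear_combination (4 * p.1 * (1 - p.1)) * Real.sin_sq_add_cos_sq (2 * Real.pi * p.2)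

theorem inner_sph (x : EuclideanSpace ℝ (Fin 3)) (p : ℝ × ℝ) :
    inner ℝ x (sph p) = √(4 * p.1 * (1 - p.1)) *
      (x 0 * Real.cos (2 * Real.pi * p.2) + x 1 * Real.sin (2 * Real.pi * p.2)) +
      x 2 * (1 - 2 * p.1) := by
  simp [sph, PiLp.inner_apply, Fin.sum_univ_three]
  ring

theorem ae_squareMeasure : ∀ᵐ p ∂squareMeasure, p.1 ∈ Ioo (0 : ℝ) 1 := by
  have h : ∀ᵐ a ∂unitMeasure, a ∈ Ioo (0 : ℝ) 1 := by
    rw [unitMeasure, ← restrict_Ioo_eq_restrict_Ioc]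
    exact ae_restrict_mem measurableSet_Ioo
  exact Measure.quasiMeasurePreserving_fst.ae h

theorem integral_one_sub_two_mul_pow (l : ℕ) :
    ∫ a in (0 : ℝ)..1, (1 - 2 * a) ^ l = (1 + (-1) ^ l) / (2 * (l + 1)) := by
  have := intervalIntegral.integral_comp_sub_mul (fun t : ℝ => t ^ l) (two_ne_zero) (1 : ℝ)
    (a := 0) (b := 1)
  rw [this, integral_pow]
  have : (l : ℝ) + 1 ≠ 0 := by positivity
  norm_num
  field_simp
  ring

theorem integral_weight_recursion (i l : ℕ) :
    (l + 1) * ∫ a in (0 : ℝ)..1, (4 * a * (1 - a)) ^ (i + 1) * (1 - 2 * a) ^ l =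
      2 * (i + 1) * ∫ a in (0 : ℝ)..1, (4 * a * (1 - a)) ^ i * (1 - 2 * a) ^ (l + 2) := by
  have hd : ∀ a ∈ uIcc (0 : ℝ) 1, HasDerivAt
      (fun a : ℝ => (4 * a * (1 - a)) ^ (i + 1) * (1 - 2 * a) ^ (l + 1))
      (4 * (i + 1) * ((4 * a * (1 - a)) ^ i * (1 - 2 * a) ^ (l + 2)) -
        2 * (l + 1) * ((4 * a * (1 - a)) ^ (i + 1) * (1 - 2 * a) ^ l)) a := by
    intro a _
    have h1 : HasDerivAt (fun a : ℝ => 4 * a * (1 - a)) (4 * (1 - 2 * a)) a := by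
      refine (((hasDerivAt_id' a).const_mul 4).fun_mul ((hasDerivAt_id' a).const_sub 1)).congr_deriv ?_
      ring
    have h2 : HasDerivAt (fun a : ℝ => 1 - 2 * a) (-2) a := by
      refine (((hasDerivAt_id' a).const_mul 2).const_sub 1).congr_deriv ?_
      ring
    refine ((h1.fun_pow (i + 1)).fun_mul (h2.fun_pow (l + 1))).congr_deriv ?_
    simp only [Nat.add_sub_cancel]
    push_cast
    ring
  have := intervalIntegral.integral_eq_sub_of_hasDerivAt hd
    (Continuous.intervalIntegrable (by fun_prop) _ _)
  rw [intervalIntegral.integral_sub (Continuous.intervalIntegrable (by fun_prop) _ _)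
    (Continuous.intervalIntegrable (by fun_prop) _ _), intervalIntegral.integral_const_mul,
    intervalIntegral.integral_const_mul] at this
  simp at this
  linarith

theorem integral_weight_odd (i l : ℕ) (hl : Odd l) :
    ∫ a in (0 : ℝ)..1, (4 * a * (1 - a)) ^ i * (1 - 2 * a) ^ l = 0 := by
  induction i generalizing l with
  | zero => simp [integral_one_sub_two_mul_pow, hl.neg_one_pow]
  | succ i ih =>
    have := integral_weight_recursion i l
    rw [ih (l + 2) (by simpa [parity_simps] using hl), mul_zero] at this
    exact (mul_eq_zero.1 this).resolve_left (by positivity)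

theorem integral_trig_recursion (u v : ℝ) (j : ℕ) :
    (j + 2) * ∫ b in (0 : ℝ)..1,
        (u * Real.cos (2 * Real.pi * b) + v * Real.sin (2 * Real.pi * b)) ^ (j + 2) =
      (j + 1) * (u ^ 2 + v ^ 2) * ∫ b in (0 : ℝ)..1,
        (u * Real.cos (2 * Real.pi * b) + v * Real.sin (2 * Real.pi * b)) ^ j := by
  have hpi := Real.pi_ne_zero
  have hd : ∀ b ∈ uIcc (0 : ℝ) 1, HasDerivAt
      (fun b : ℝ => (u * Real.cos (2 * Real.pi * b) + v * Real.sin (2 * Real.pi * b)) ^ (j + 1) *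
        (v * Real.cos (2 * Real.pi * b) - u * Real.sin (2 * Real.pi * b)))
      (2 * Real.pi * ((j + 1) * (u ^ 2 + v ^ 2)) *
        (u * Real.cos (2 * Real.pi * b) + v * Real.sin (2 * Real.pi * b)) ^ j -
      2 * Real.pi * (j + 2) *
        (u * Real.cos (2 * Real.pi * b) + v * Real.sin (2 * Real.pi * b)) ^ (j + 2)) b := by
    intro b _
    have h0 : HasDerivAt (fun b : ℝ => 2 * Real.pi * b) (2 * Real.pi) b := by
      simpa using (hasDerivAt_id b).const_mul (2 * Real.pi)
    have hc := h0.cos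
    have hs := h0.sin
    refine ((((hc.const_mul u).fun_add (hs.const_mul v)).fun_pow (j + 1)).fun_mul
      ((hc.const_mul v).fun_sub (hs.const_mul u))).congr_deriv ?_
    simp only [Nat.add_sub_cancel]
    set C := Real.cos (2 * Real.pi * b)
    set S := Real.sin (2 * Real.pi * b)
    have hCS : S ^ 2 + C ^ 2 = 1 := Real.sin_sq_add_cos_sq _
    push_cast
    linear_combination (2 * Real.pi * (j + 1) * (u ^ 2 + v ^ 2) * (u * C + v * S) ^ j) * hCS
  have := intervalIntegral.integral_eq_sub_of_hasDerivAt hd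
    (Continuous.intervalIntegrable (by fun_prop) _ _)
  rw [intervalIntegral.integral_sub (Continuous.intervalIntegrable (by fun_prop) _ _)
    (Continuous.intervalIntegrable (by fun_prop) _ _), intervalIntegral.integral_const_mul,
    intervalIntegral.integral_const_mul] at this
  simp at this
  have h2 : (2 * Real.pi) * ((j + 2) * (∫ b in (0 : ℝ)..1,
        (u * Real.cos (2 * Real.pi * b) + v * Real.sin (2 * Real.pi * b)) ^ (j + 2)) -
      (j + 1) * (u ^ 2 + v ^ 2) * ∫ b in (0 : ℝ)..1,
        (u * Real.cos (2 * Real.pi * b) + v * Real.sin (2 * Real.pi * b)) ^ j) = 0 := by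
    linarith
  have := (mul_eq_zero.1 h2).resolve_left (by positivity)
  linarith

theorem integral_trig_odd (u v : ℝ) (i : ℕ) :
    ∫ b in (0 : ℝ)..1,
      (u * Real.cos (2 * Real.pi * b) + v * Real.sin (2 * Real.pi * b)) ^ (2 * i + 1) = 0 := by
  induction i with
  | zero =>
    have hpi := Real.pi_ne_zero
    simp only [mul_zero, zero_add, pow_one]
    rw [intervalIntegral.integral_add (Continuous.intervalIntegrable (by fun_prop) _ _)
      (Continuous.intervalIntegrable (by fun_prop) _ _), intervalIntegral.integral_const_mul,
      intervalIntegral.integral_const_mul,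
      intervalIntegral.integral_comp_mul_left (fun t => Real.cos t) (by positivity),
      intervalIntegral.integral_comp_mul_left (fun t => Real.sin t) (by positivity)]
    simp
  | succ i ih =>
    have := integral_trig_recursion u v (2 * i + 1)
    rw [ih, mul_zero] at this
    exact (mul_eq_zero.1 this).resolve_left (by positivity)

theorem choose_mul_integral_trig_mul_integral_weight (u v : ℝ) (i t : ℕ) :
    ((2 * (i + t)).choose (2 * i) : ℝ) *
      (∫ b in (0 : ℝ)..1,
        (u * Real.cos (2 * Real.pi * b) + v * Real.sin (2 * Real.pi * b)) ^ (2 * i)) *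
      (∫ a in (0 : ℝ)..1, (4 * a * (1 - a)) ^ i * (1 - 2 * a) ^ (2 * t)) =
    (i + t).choose i * (u ^ 2 + v ^ 2) ^ i / (2 * (i + t) + 1) := by
  induction i generalizing t with
  | zero =>
    have := integral_one_sub_two_mul_pow (2 * t)
    simp [this]
    field_simp
    norm_num
  | succ i ih =>
    have h1 := integral_trig_recursion u v (2 * i)
    have h2 := integral_weight_recursion i (2 * t)
    have h3 := ih (t + 1)
    rw [show 2 * (t + 1) = 2 * t + 2 by ring, show i + (t + 1) = i + 1 + t by ring] at h3
    have c1 := Nat.choose_succ_right_eq (i + 1 + t) i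
    have c2 := Nat.choose_succ_right_eq (2 * (i + 1 + t)) (2 * i)
    have c3 := Nat.choose_succ_right_eq (2 * (i + 1 + t)) (2 * i + 1)
    rw [show i + 1 + t - i = t + 1 by omega] at c1
    rw [show 2 * (i + 1 + t) - 2 * i = 2 * t + 2 by omega] at c2
    rw [show 2 * (i + 1 + t) - (2 * i + 1) = 2 * t + 1 by omega] at c3
    rw [show 2 * (i + 1) = 2 * i + 2 by ring]
    set G := ∫ b in (0 : ℝ)..1,
        (u * Real.cos (2 * Real.pi * b) + v * Real.sin (2 * Real.pi * b)) ^ (2 * i)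
    set G' := ∫ b in (0 : ℝ)..1,
        (u * Real.cos (2 * Real.pi * b) + v * Real.sin (2 * Real.pi * b)) ^ (2 * i + 2)
    set D := ∫ a in (0 : ℝ)..1, (4 * a * (1 - a)) ^ i * (1 - 2 * a) ^ (2 * t + 2)
    set D' := ∫ a in (0 : ℝ)..1, (4 * a * (1 - a)) ^ (i + 1) * (1 - 2 * a) ^ (2 * t)
    have c1' : ((i + 1 + t).choose (i + 1) : ℝ) * (i + 1) = (i + 1 + t).choose i * (t + 1) := by
      exact_mod_cast c1
    have c2' : ((2 * (i + 1 + t)).choose (2 * i + 1) : ℝ) * (2 * i + 1) =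
        (2 * (i + 1 + t)).choose (2 * i) * (2 * t + 2) := by exact_mod_cast c2
    have c3' : ((2 * (i + 1 + t)).choose (2 * i + 2) : ℝ) * (2 * i + 2) =
        (2 * (i + 1 + t)).choose (2 * i + 1) * (2 * t + 1) := by exact_mod_cast c3
    push_cast at h1 h2 h3 ⊢
    have e1 : ((2 * (i + 1 + t)).choose (2 * i + 1) : ℝ) =
      (2 * (i + 1 + t)).choose (2 * i) * (2 * t + 2) / (2 * i + 1) := by
      rw [eq_div_iff (by positivity)]; exact c2'
    have e2 : ((2 * (i + 1 + t)).choose (2 * i + 2) : ℝ) =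
      (2 * (i + 1 + t)).choose (2 * i) * (2 * t + 2) / (2 * i + 1) * (2 * t + 1) /
        (2 * i + 2) := by
      rw [eq_div_iff (by positivity), c3', e1]
    have e3 : ((i + 1 + t).choose (i + 1) : ℝ) = (i + 1 + t).choose i * (t + 1) / (i + 1) := by
      rw [eq_div_iff (by positivity)]; exact c1'
    have e4 : G' = (2 * i + 1) * (u ^ 2 + v ^ 2) * G / (2 * i + 2) := by
      rw [eq_div_iff (by positivity), ← h1]; ring
    have e5 : D' = 2 * (i + 1) * D / (2 * t + 1) := by
      rw [eq_div_iff (by positivity), ← h2]; ring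
    rw [e2, e3, e4, e5]
    have h4 : ((2 * (i + 1 + t)).choose (2 * i) : ℝ) * G * D * (2 * (i + 1 + t) + 1) =
        (i + 1 + t).choose i * (u ^ 2 + v ^ 2) ^ i := by
      rw [h3]; field_simp; ring
    rw [pow_succ (u ^ 2 + v ^ 2) i]
    have : ((i + 1 + t).choose i * (t + 1) / (i + 1) * ((u ^ 2 + v ^ 2) ^ i * (u ^ 2 + v ^ 2)) : ℝ) =
        (i + 1 + t).choose i * (u ^ 2 + v ^ 2) ^ i * ((t + 1) / (i + 1) * (u ^ 2 + v ^ 2)) := by ring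
    rw [this, ← h4]
    field_simp

theorem sum_range_two_mul_add_one {f : ℕ → ℝ} (hf : ∀ i, f (2 * i + 1) = 0) (m : ℕ) :
    ∑ j ∈ Finset.range (2 * m + 1), f j = ∑ i ∈ Finset.range (m + 1), f (2 * i) := by
  induction m with
  | zero => simp
  | succ m ih =>
    rw [Finset.sum_range_succ _ (m + 1), ← ih, show 2 * (m + 1) + 1 = 2 * m + 1 + 1 + 1 by ring,
      Finset.sum_range_succ, Finset.sum_range_succ, hf, add_zero]
    ring_nf

theorem integral_inner_sph_pow {x : EuclideanSpace ℝ (Fin 3)} (hx : ‖x‖ = 1) (n : ℕ) :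
    ∫ p, (inner ℝ x (sph p)) ^ n ∂squareMeasure = ∫ a in (0 : ℝ)..1, (1 - 2 * a) ^ n := by
  have hx2 : x 0 ^ 2 + x 1 ^ 2 + x 2 ^ 2 = 1 := by
    rw [EuclideanSpace.norm_eq, Real.sqrt_eq_one, Fin.sum_univ_three] at hx
    simpa using hx
  have hexp : ∀ p : ℝ × ℝ, (inner ℝ x (sph p)) ^ n = ∑ j ∈ Finset.range (n + 1),
      (√(4 * p.1 * (1 - p.1)) ^ j * (x 2 * (1 - 2 * p.1)) ^ (n - j) * n.choose j) *
      (x 0 * Real.cos (2 * Real.pi * p.2) + x 1 * Real.sin (2 * Real.pi * p.2)) ^ j := by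
    intro p
    rw [inner_sph, add_pow]
    refine Finset.sum_congr rfl fun j _ => ?_
    rw [mul_pow]; ring
  simp_rw [hexp]
  rw [integral_finsetSum]
  swap
  · intro j _
    exact Integrable.mul_prod
      (f := fun a : ℝ => √(4 * a * (1 - a)) ^ j * (x 2 * (1 - 2 * a)) ^ (n - j) * n.choose j)
      (g := fun b : ℝ => (x 0 * Real.cos (2 * Real.pi * b) + x 1 * Real.sin (2 * Real.pi * b)) ^ j)
      (integrable_unitMeasure_of_continuous (by fun_prop))
      (integrable_unitMeasure_of_continuous (by fun_prop))
  have hprod : ∀ j, ∫ p : ℝ × ℝ, (√(4 * p.1 * (1 - p.1)) ^ j * (x 2 * (1 - 2 * p.1)) ^ (n - j) *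
        n.choose j) *
      (x 0 * Real.cos (2 * Real.pi * p.2) + x 1 * Real.sin (2 * Real.pi * p.2)) ^ j
        ∂squareMeasure =
      (∫ a in (0 : ℝ)..1, √(4 * a * (1 - a)) ^ j * (x 2 * (1 - 2 * a)) ^ (n - j) * n.choose j) *
      ∫ b in (0 : ℝ)..1,
        (x 0 * Real.cos (2 * Real.pi * b) + x 1 * Real.sin (2 * Real.pi * b)) ^ j := by
    intro j
    rw [← integral_unitMeasure, ← integral_unitMeasure, ← integral_prod_mul]
    rfl
  simp_rw [hprod]
  have hodd : ∀ i, (∫ a in (0 : ℝ)..1, √(4 * a * (1 - a)) ^ (2 * i + 1) *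
      (x 2 * (1 - 2 * a)) ^ (n - (2 * i + 1)) * n.choose (2 * i + 1)) *
      ∫ b in (0 : ℝ)..1,
        (x 0 * Real.cos (2 * Real.pi * b) + x 1 * Real.sin (2 * Real.pi * b)) ^ (2 * i + 1) = 0 := by
    intro i
    rw [integral_trig_odd, mul_zero]
  have heven : ∀ i, (∫ a in (0 : ℝ)..1, √(4 * a * (1 - a)) ^ (2 * i) *
      (x 2 * (1 - 2 * a)) ^ (n - 2 * i) * n.choose (2 * i)) =
      n.choose (2 * i) * x 2 ^ (n - 2 * i) *
        ∫ a in (0 : ℝ)..1, (4 * a * (1 - a)) ^ i * (1 - 2 * a) ^ (n - 2 * i) := by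
    intro i
    rw [← intervalIntegral.integral_const_mul]
    refine intervalIntegral.integral_congr fun a ha => ?_
    rw [uIcc_of_le zero_le_one] at ha
    have hw : 0 ≤ 4 * a * (1 - a) := mul_nonneg (by linarith [ha.1]) (by linarith [ha.2])
    simp only [pow_mul, Real.sq_sqrt hw, mul_pow]
    ring
  rcases Nat.even_or_odd n with hn | hn
  · obtain ⟨m, rfl⟩ := hn
    rw [← two_mul] at *
    rw [sum_range_two_mul_add_one hodd, integral_one_sub_two_mul_pow]
    have key : ∀ i ∈ Finset.range (m + 1), (∫ a in (0 : ℝ)..1, √(4 * a * (1 - a)) ^ (2 * i) *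
      (x 2 * (1 - 2 * a)) ^ (2 * m - 2 * i) * (2 * m).choose (2 * i)) *
      ∫ b in (0 : ℝ)..1,
        (x 0 * Real.cos (2 * Real.pi * b) + x 1 * Real.sin (2 * Real.pi * b)) ^ (2 * i) =
      ((x 0 ^ 2 + x 1 ^ 2) ^ i * (x 2 ^ 2) ^ (m - i) * m.choose i) / (2 * m + 1) := by
      intro i hi
      obtain ⟨t, rfl⟩ := Nat.exists_eq_add_of_le (Nat.lt_succ_iff.1 (Finset.mem_range.1 hi))
      rw [heven, show 2 * (i + t) - 2 * i = 2 * t by omega, show i + t - i = t by omega]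
      have := choose_mul_integral_trig_mul_integral_weight (x 0) (x 1) i t
      push_cast
      rw [← pow_mul]
      linear_combination x 2 ^ (2 * t) * this
    rw [Finset.sum_congr rfl key, ← Finset.sum_div, ← add_pow, hx2]
    simp
    field_simp
    norm_num
  · rw [integral_one_sub_two_mul_pow, hn.neg_one_pow]
    simp only [add_neg_cancel, zero_div]
    refine Finset.sum_eq_zero fun j hj => ?_
    rcases Nat.even_or_odd' j with ⟨i, rfl | rfl⟩
    · rw [heven, integral_weight_odd, mul_zero, zero_mul]
      have := Nat.lt_succ_iff.1 (Finset.mem_range.1 hj)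
      exact Nat.Odd.sub_even this hn (even_two_mul i)
    · exact hodd i

theorem inner_pow_eq_sum (x y : EuclideanSpace ℝ (Fin 3)) (k : ℕ) :
    (inner ℝ x y) ^ k = ∑ f : Fin k → Fin 3, (∏ j, x (f j)) * ∏ j, y (f j) := by
  have : inner ℝ x y = ∑ c, x c * y c := by
    simp [PiLp.inner_apply, mul_comm]
  rw [this, Fintype.sum_pow]
  simp_rw [Finset.prod_mul_distrib]

theorem integrable_prod_sph {k : ℕ} (f : Fin k → Fin 3) :
    Integrable (fun p => ∏ j, sph p (f j)) squareMeasure := by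
  refine Integrable.of_bound (C := 1) ?_ ?_
  · refine Continuous.aestronglyMeasurable ?_
    have := continuous_sph
    fun_prop
  · filter_upwards [ae_squareMeasure] with p hp
    rw [norm_prod]
    refine Finset.prod_le_one (fun _ _ => norm_nonneg _) fun j _ => ?_
    exact (PiLp.norm_apply_le _ _).trans (norm_sph hp.1.le hp.2.le).le

/-- The uniform measure minimizes the energy of the positive definite kernel `⟪x, y⟫ ^ k`. -/
theorem sq_mul_moment_le_sum_inner_pow {N : ℕ} {q : Fin N → EuclideanSpace ℝ (Fin 3)}
    (hq : ∀ i, ‖q i‖ = 1) (k : ℕ) :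
    (N : ℝ) ^ 2 * ∫ t in (0 : ℝ)..1, (1 - 2 * t) ^ k ≤ ∑ i, ∑ j, (inner ℝ (q i) (q j)) ^ k := by
  set M := ∫ t in (0 : ℝ)..1, (1 - 2 * t) ^ k
  let A : (Fin k → Fin 3) → ℝ := fun f => ∑ i, ∏ j, q i (f j)
  let m : (Fin k → Fin 3) → ℝ := fun f => ∫ p, ∏ j, sph p (f j) ∂squareMeasure
  have hpt : ∀ x : EuclideanSpace ℝ (Fin 3), ‖x‖ = 1 → ∑ f, (∏ j, x (f j)) * m f = M := by
    intro x hx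
    rw [show M = _ from (integral_inner_sph_pow hx k).symm]
    simp_rw [inner_pow_eq_sum]
    rw [integral_finsetSum _ fun f _ => (integrable_prod_sph f).const_mul _]
    simp_rw [integral_const_mul]
    rfl
  have hAA : ∑ f, A f ^ 2 = ∑ i, ∑ j, (inner ℝ (q i) (q j)) ^ k := by
    simp_rw [inner_pow_eq_sum, A, sq, Finset.sum_mul_sum]
    rw [Finset.sum_comm]
    refine Finset.sum_congr rfl fun i _ => ?_
    rw [Finset.sum_comm]
  have hAm : ∑ f, A f * m f = N * M := by
    simp_rw [A, Finset.sum_mul]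
    rw [Finset.sum_comm, Finset.sum_congr rfl fun i _ => hpt (q i) (hq i)]
    simp
  have hmm : ∑ f, m f ^ 2 = M := by
    have h1 : ∑ f, m f ^ 2 = ∫ p, ∑ f, (∏ j, sph p (f j)) * m f ∂squareMeasure := by
      rw [integral_finsetSum _ fun f _ => (integrable_prod_sph f).mul_const _]
      simp_rw [integral_mul_const, sq]
      rfl
    have h2 : ∀ᵐ p ∂squareMeasure, ∑ f, (∏ j, sph p (f j)) * m f = M := by
      filter_upwards [ae_squareMeasure] with p hp
      exact hpt _ (norm_sph hp.1.le hp.2.le)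
    rw [h1, integral_congr_ae h2]
    simp
  have h0 : 0 ≤ ∑ f, (A f - N * m f) ^ 2 := Finset.sum_nonneg fun f _ => sq_nonneg _
  have h1 : ∑ f, (A f - N * m f) ^ 2 =
      ∑ f, A f ^ 2 - 2 * N * ∑ f, A f * m f + N ^ 2 * ∑ f, m f ^ 2 := by
    rw [Finset.mul_sum, Finset.mul_sum, ← Finset.sum_sub_distrib, ← Finset.sum_add_distrib]
    exact Finset.sum_congr rfl fun f _ => by ring
  rw [h1, hAA, hAm, hmm] at h0
  nlinarith

theorem sum_coeff_mul_le_energy_sub_mean {N : ℕ} {q : Fin N → EuclideanSpace ℝ (Fin 3)}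
    (hq : ∀ i, ‖q i‖ = 1) {a : ℕ → ℝ} {g : ℝ → ℝ} (ha : ∀ k, 1 ≤ k → 0 ≤ a k)
    (hg : ∀ u, |u| ≤ 1 → HasSum (fun k => a k * u ^ k) (g u)) (S : Finset ℕ) :
    ∑ k ∈ S, a k * (∑ i, ∑ j, (inner ℝ (q i) (q j)) ^ k -
        (N : ℝ) ^ 2 * ∫ t in (0 : ℝ)..1, (1 - 2 * t) ^ k) ≤
      ∑ i, ∑ j, g (inner ℝ (q i) (q j)) - (N : ℝ) ^ 2 * ∫ t in (0 : ℝ)..1, g (1 - 2 * t) := by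
  have hle : ∀ i j, |inner ℝ (q i) (q j)| ≤ 1 := fun i j => by
    simpa [hq] using abs_real_inner_le_norm (q i) (q j)
  have hsum : Summable a := by simpa using (hg 1 (by simp)).summable
  have h1 : HasSum (fun k => ∑ i, ∑ j, a k * (inner ℝ (q i) (q j)) ^ k)
      (∑ i, ∑ j, g (inner ℝ (q i) (q j))) :=
    hasSum_sum fun i _ => hasSum_sum fun j _ => hg _ (hle i j)
  have hmem : ∀ t ∈ uIcc (0 : ℝ) 1, |1 - 2 * t| ≤ 1 := by
    intro t ht
    rw [uIcc_of_le zero_le_one] at ht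
    exact abs_le.2 ⟨by linarith [ht.2], by linarith [ht.1]⟩
  have h2 : HasSum (fun k => ∫ t in (0 : ℝ)..1, a k * (1 - 2 * t) ^ k)
      (∫ t in (0 : ℝ)..1, ∑' k, a k * (1 - 2 * t) ^ k) := by
    refine intervalIntegral.hasSum_intervalIntegral_of_summable_norm
      (f := fun k => (⟨fun t : ℝ => a k * (1 - 2 * t) ^ k, by fun_prop⟩ : C(ℝ, ℝ))) ?_
    refine Summable.of_nonneg_of_le (fun _ => norm_nonneg _) (fun k => ?_) hsum.norm
    rw [ContinuousMap.norm_le _ (norm_nonneg _)]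
    intro t
    have := hmem t.1 t.2
    simp only [ContinuousMap.restrict_apply, ContinuousMap.coe_mk, norm_mul, norm_pow]
    exact mul_le_of_le_one_right (norm_nonneg _) (pow_le_one₀ (norm_nonneg _) this)
  have h3 : ∫ t in (0 : ℝ)..1, ∑' k, a k * (1 - 2 * t) ^ k = ∫ t in (0 : ℝ)..1, g (1 - 2 * t) :=
    intervalIntegral.integral_congr fun t ht => (hg _ (hmem t ht)).tsum_eq
  rw [h3] at h2
  have h4 := h1.sub (h2.mul_left ((N : ℝ) ^ 2))
  have h5 : ∀ k, ∑ i, ∑ j, a k * (inner ℝ (q i) (q j)) ^ k -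
      (N : ℝ) ^ 2 * ∫ t in (0 : ℝ)..1, a k * (1 - 2 * t) ^ k =
      a k * (∑ i, ∑ j, (inner ℝ (q i) (q j)) ^ k -
        (N : ℝ) ^ 2 * ∫ t in (0 : ℝ)..1, (1 - 2 * t) ^ k) := by
    intro k
    simp_rw [← Finset.mul_sum, intervalIntegral.integral_const_mul]
    ring
  simp_rw [h5] at h4
  refine sum_le_hasSum S (fun k _ => ?_) h4
  rcases Nat.eq_zero_or_pos k with rfl | hk
  · simp [sq]
  · exact mul_nonneg (ha k hk) (sub_nonneg.2 (sq_mul_moment_le_sum_inner_pow hq k))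

/-- Up to sign, the coefficient of `x ^ k` in the expansion of `(1 - x) ^ b`. -/
noncomputable def binomCoeff (b : ℝ) (k : ℕ) : ℝ := (-1) ^ k * Ring.choose b k

theorem binomCoeff_zero (b : ℝ) : binomCoeff b 0 = 1 := by simp [binomCoeff]

theorem binomCoeff_succ (b : ℝ) (k : ℕ) :
    (k + 1) * binomCoeff b (k + 1) = (k - b) * binomCoeff b k := by
  have h1 := Ring.descPochhammer_eq_factorial_smul_choose b k
  have h2 := Ring.descPochhammer_eq_factorial_smul_choose b (k + 1)
  rw [descPochhammer_succ_right, Polynomial.smeval_mul, h1] at h2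
  have hk : (k.factorial : ℝ) ≠ 0 := by positivity
  simp [Polynomial.smeval_natCast, Nat.factorial_succ] at h2
  unfold binomCoeff
  apply mul_left_cancel₀ hk
  rw [pow_succ]
  linear_combination -(-1) ^ k * (-1) * h2

theorem hasSum_one_sub_rpow (b : ℝ) {x : ℝ} (hx : |x| < 1) :
    HasSum (fun k => binomCoeff b k * x ^ k) ((1 - x) ^ b) := by
  have h := (Real.one_add_rpow_hasFPowerSeriesOnBall_zero (a := b)).hasSum (y := -x)
    (by simpa [enorm_eq_nnnorm, ← NNReal.coe_lt_one] using hx)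
  rw [zero_add, ← sub_eq_add_neg] at h
  refine h.congr_fun fun k => ?_
  rw [binomialSeries_apply]
  simp [binomCoeff, neg_pow x]
  ring

theorem binomCoeff_nonneg_of_nonpos {b : ℝ} (hb : b ≤ 0) (k : ℕ) : 0 ≤ binomCoeff b k := by
  induction k with
  | zero => simp [binomCoeff_zero]
  | succ k ih =>
    have h := binomCoeff_succ b k
    have : 0 ≤ (k - b) * binomCoeff b k := mul_nonneg (by have : (0 : ℝ) ≤ k := by positivity
                                                          linarith) ih
    rw [← h] at this
    exact nonneg_of_mul_nonneg_right this (by positivity)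

theorem le_neg_binomCoeff {b : ℝ} (hb0 : 0 < b) (hb1 : b < 1) (k : ℕ) :
    b * (1 - b) * ((k : ℝ) + 2) ^ (-1 - b) ≤ -binomCoeff b (k + 2) := by
  have h1 : b * (1 - b) * ((k : ℝ) + 1) ^ (-b) ≤ (k + 2) * -binomCoeff b (k + 2) := by
    induction k with
    | zero =>
      have h0 := binomCoeff_succ b 0
      have h1 := binomCoeff_succ b 1
      simp [binomCoeff_zero] at h0 h1 ⊢
      rw [h0] at h1
      nlinarith
    | succ k ih =>
      have h := binomCoeff_succ b (k + 2)
      have hk : (0 : ℝ) < k + 1 := by positivity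
      push_cast at h ⊢
      have e : ((k : ℝ) + 1 + 2) * -binomCoeff b (k + 1 + 2) =
          (1 - b / (k + 2)) * ((k + 2) * -binomCoeff b (k + 2)) := by
        rw [show k + 1 + 2 = k + 2 + 1 by ring]
        field_simp
        linarith
      have hber : (((k : ℝ) + 1 + 1) / (k + 1)) ^ (-b) ≤ 1 - b / (k + 2) := by
        have := rpow_one_add_le_one_add_mul_self (s := -1 / ((k : ℝ) + 2)) (p := b)
          (by rw [le_div_iff₀ (by positivity)]; linarith) hb0.le hb1.le
        rw [Real.rpow_neg (by positivity), ← Real.inv_rpow (by positivity), inv_div]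
        convert this using 1
        · congr 1
          field_simp
          ring
        · ring
      calc b * (1 - b) * ((k : ℝ) + 1 + 1) ^ (-b)
          = (((k : ℝ) + 1 + 1) / (k + 1)) ^ (-b) * (b * (1 - b) * ((k : ℝ) + 1) ^ (-b)) := by
            rw [Real.div_rpow (by positivity) (by positivity)]
            field_simp
        _ ≤ (1 - b / (k + 2)) * ((k + 2) * -binomCoeff b (k + 2)) := by
            refine mul_le_mul hber ih ?_ (le_trans (by positivity) hber)
            exact mul_nonneg (mul_nonneg hb0.le (by linarith)) (by positivity)
        _ = _ := e.symm
  have hk : (0 : ℝ) < k + 2 := by positivity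
  have h2 : ((k : ℝ) + 2) ^ (-b) ≤ ((k : ℝ) + 1) ^ (-b) :=
    Real.rpow_le_rpow_of_nonpos (by positivity) (by linarith) (by linarith)
  rw [show -1 - b = -b - 1 by ring, Real.rpow_sub_one hk.ne', ← mul_div_assoc, div_le_iff₀ hk]
  have := mul_le_mul_of_nonneg_left h2 (mul_nonneg hb0.le (sub_nonneg.2 hb1.le))
  linarith

theorem neg_binomCoeff_nonneg {b : ℝ} (hb0 : 0 < b) (hb1 : b < 1) {k : ℕ} (hk : 1 ≤ k) :
    0 ≤ -binomCoeff b k := by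
  obtain ⟨k, rfl⟩ := Nat.exists_eq_add_of_le' hk
  rcases k with _ | k
  · have h0 := binomCoeff_succ b 0
    simp [binomCoeff_zero] at h0 ⊢
    linarith
  · refine le_trans ?_ (le_neg_binomCoeff hb0 hb1 k)
    exact mul_nonneg (mul_nonneg hb0.le (by linarith)) (by positivity)

theorem norm_sub_rpow {x y : EuclideanSpace ℝ (Fin 3)} (hx : ‖x‖ = 1) (hy : ‖y‖ = 1) (s : ℝ) :
    ‖x - y‖ ^ (-s) = 2 ^ (-s / 2) * (1 - inner ℝ x y) ^ (-s / 2) := by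
  have h : ‖x - y‖ ^ 2 = 2 * (1 - inner ℝ x y) := by
    rw [norm_sub_sq_real, hx, hy]; ring
  have h1 : inner ℝ x y ≤ 1 := by simpa [hx, hy] using real_inner_le_norm x y
  rw [← Real.mul_rpow zero_le_two (by linarith), ← h, ← Real.rpow_natCast_mul (norm_nonneg _)]
  congr 1
  push_cast
  ring

theorem hasSum_shifted_rpow (b : ℝ) {d : ℝ} (hd : 0 < d) {u : ℝ} (hu : |u| ≤ 1) :
    HasSum (fun k => (1 + d) ^ b * (binomCoeff b k * ((1 + d)⁻¹) ^ k) * u ^ k)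
      ((1 + d - u) ^ b) := by
  have hd1 : 0 < 1 + d := by linarith
  have hx : |(1 + d)⁻¹ * u| < 1 := by
    rw [abs_mul, abs_of_pos (inv_pos.2 hd1), inv_mul_lt_iff₀ hd1]
    linarith
  have h := (hasSum_one_sub_rpow b hx).mul_left ((1 + d) ^ b)
  have h1 := abs_lt.1 hx
  rw [← Real.mul_rpow hd1.le (by linarith)] at h
  have e : (1 + d) * (1 - (1 + d)⁻¹ * u) = 1 + d - u := by field_simp
  rw [e] at h
  refine h.congr_fun fun k => ?_
  rw [mul_pow]; ring

theorem integral_shifted_rpow {b : ℝ} (hb : -1 < b) (d : ℝ) :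
    ∫ t in (0 : ℝ)..1, (1 + d - (1 - 2 * t)) ^ b =
      ((2 + d) ^ (1 + b) - d ^ (1 + b)) / (2 * (1 + b)) := by
  have h : ∀ t : ℝ, 1 + d - (1 - 2 * t) = d + 2 * t := fun t => by ring
  simp_rw [h]
  rw [intervalIntegral.integral_comp_add_mul (fun t : ℝ => t ^ b) two_ne_zero,
    integral_rpow (Or.inl hb)]
  have : 1 + b ≠ 0 := by linarith
  rw [add_comm b 1]
  norm_num
  rw [add_comm d 2]
  field_simp

theorem two_rpow_mul_eq_Wenergy (s : ℝ) :
    2 ^ (-s / 2) * (2 ^ (1 + -s / 2) / (2 * (1 + -s / 2))) = Wenergy s := by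
  unfold Wenergy
  rw [← mul_div_assoc, ← Real.rpow_add two_pos]
  congr 2 <;> ring

/-- The Riesz energy of a configuration; the diagonal terms vanish since `0 ^ (-s) = 0`
for `s ≠ 0`. -/
noncomputable def rieszEnergy (s : ℝ) {N : ℕ} (q : Fin N → EuclideanSpace ℝ (Fin 3)) : ℝ :=
  ∑ i, ∑ j, ‖q i - q j‖ ^ (-s)

theorem rieszEnergy_eq {s : ℝ} {N : ℕ} {q : Fin N → EuclideanSpace ℝ (Fin 3)}
    (hq : ∀ i, ‖q i‖ = 1) :
    rieszEnergy s q = 2 ^ (-s / 2) * ∑ i, ∑ j, (1 - inner ℝ (q i) (q j)) ^ (-s / 2) := by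
  simp_rw [rieszEnergy, norm_sub_rpow (hq _) (hq _), Finset.mul_sum]

theorem le_rieszEnergy_of_pos {s : ℝ} (hs0 : 0 < s) (hs2 : s < 2) :
    ∃ K : ℝ, 0 < K ∧ ∀ N : ℕ, 1 ≤ N → ∀ q : Fin N → EuclideanSpace ℝ (Fin 3),
      (∀ i, ‖q i‖ = 1) → Function.Injective q →
      Wenergy s * (N : ℝ) ^ 2 - K * (N : ℝ) ^ (1 + s / 2) ≤ rieszEnergy s q := by
  set b := -s / 2 with hb
  have hb1 : 0 < 1 + b := by rw [hb]; linarith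
  refine ⟨2 ^ b * (1 / (2 * (1 + b)) + 1), by positivity, fun N hN q hq hinj => ?_⟩
  have hN0 : (0 : ℝ) < N := by exact_mod_cast hN
  set d : ℝ := 1 / N with hd
  have hd0 : 0 < d := by positivity
  have hle : ∀ i j, inner ℝ (q i) (q j) ≤ 1 := fun i j => by
    simpa [hq] using real_inner_le_norm (q i) (q j)
  have h1 := sum_coeff_mul_le_energy_sub_mean hq
    (a := fun k => (1 + d) ^ b * (binomCoeff b k * ((1 + d)⁻¹) ^ k))
    (g := fun u => (1 + d - u) ^ b)
    (fun k _ => mul_nonneg (by positivity) (mul_nonneg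
      (binomCoeff_nonneg_of_nonpos (by rw [hb]; linarith) k) (by positivity)))
    (fun u hu => hasSum_shifted_rpow b hd0 hu) ∅
  rw [Finset.sum_empty, integral_shifted_rpow (by linarith) d] at h1
  have h2 : ∑ i, ∑ j, (1 + d - inner ℝ (q i) (q j)) ^ b ≤
      ∑ i, ∑ j, ((if i = j then d ^ b else 0) + (1 - inner ℝ (q i) (q j)) ^ b) := by
    refine Finset.sum_le_sum fun i _ => Finset.sum_le_sum fun j _ => ?_
    have hbneg : b < 0 := by rw [hb]; linarith
    split_ifs with hij
    · subst hij
      simp [hq, Real.zero_rpow hbneg.ne]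
    · have : inner ℝ (q i) (q j) ≠ (1 : ℝ) := fun h =>
        hij (hinj ((inner_eq_one_iff_of_norm_eq_one (hq i) (hq j)).1 h))
      have := lt_of_le_of_ne (hle i j) this
      rw [zero_add]
      exact Real.rpow_le_rpow_of_nonpos (by linarith) (by linarith) hbneg.le
  simp_rw [Finset.sum_add_distrib] at h2
  simp only [Finset.sum_ite_eq, Finset.mem_univ, if_true, Finset.sum_const, Finset.card_univ,
    Fintype.card_fin, nsmul_eq_mul] at h2
  have h3 : (N : ℝ) * d ^ b = N ^ (1 + s / 2) := by
    rw [hd, one_div, Real.inv_rpow hN0.le, ← Real.rpow_neg hN0.le, Real.rpow_add hN0, Real.rpow_one,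
      hb, neg_div, neg_neg]
  have h4 : (N : ℝ) ^ 2 * d ^ (1 + b) = N ^ (1 + s / 2) := by
    rw [hd, one_div, Real.inv_rpow hN0.le, ← Real.rpow_neg hN0.le, ← Real.rpow_natCast,
      ← Real.rpow_add hN0]
    congr 1
    rw [hb]; push_cast; ring
  have h5 : (2 : ℝ) ^ (1 + b) ≤ (2 + d) ^ (1 + b) :=
    Real.rpow_le_rpow zero_le_two (by linarith) hb1.le
  have h6 : (N : ℝ) ^ 2 * ((2 ^ (1 + b) - d ^ (1 + b)) / (2 * (1 + b))) ≤
      (N : ℝ) ^ 2 * (((2 + d) ^ (1 + b) - d ^ (1 + b)) / (2 * (1 + b))) := by gcongr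
  have h7 : (N : ℝ) ^ 2 * (2 ^ (1 + b) / (2 * (1 + b))) -
      (1 / (2 * (1 + b)) + 1) * N ^ (1 + s / 2) ≤
      ∑ i, ∑ j, (1 - inner ℝ (q i) (q j)) ^ b := by
    have : (N : ℝ) ^ 2 * ((2 ^ (1 + b) - d ^ (1 + b)) / (2 * (1 + b))) =
      (N : ℝ) ^ 2 * (2 ^ (1 + b) / (2 * (1 + b))) - (1 / (2 * (1 + b))) *
        ((N : ℝ) ^ 2 * d ^ (1 + b)) := by ring
    rw [this, h4] at h6
    linarith
  rw [rieszEnergy_eq hq, ← two_rpow_mul_eq_Wenergy]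
  have := mul_le_mul_of_nonneg_left h7 (by positivity : (0 : ℝ) ≤ 2 ^ b)
  linarith

theorem half_le_sum_inner_pow_sub {N : ℕ} (hN : 1 ≤ N) {q : Fin N → EuclideanSpace ℝ (Fin 3)}
    (hq : ∀ i, ‖q i‖ = 1) {m : ℕ} (hm : N ≤ m) :
    (N : ℝ) / 2 ≤ ∑ i, ∑ j, (inner ℝ (q i) (q j)) ^ (2 * m) -
      (N : ℝ) ^ 2 * ∫ t in (0 : ℝ)..1, (1 - 2 * t) ^ (2 * m) := by
  have hN0 : (0 : ℝ) < N := by exact_mod_cast hN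
  have hm' : (N : ℝ) ≤ m := by exact_mod_cast hm
  have h1 : (N : ℝ) ≤ ∑ i, ∑ j, (inner ℝ (q i) (q j)) ^ (2 * m) := by
    calc (N : ℝ) = ∑ i : Fin N, ∑ j, if i = j then (1 : ℝ) else 0 := by simp
      _ ≤ _ := by
        refine Finset.sum_le_sum fun i _ => Finset.sum_le_sum fun j _ => ?_
        split_ifs with h
        · subst h; simp [hq]
        · exact (even_two_mul m).pow_nonneg _
  rw [integral_one_sub_two_mul_pow, (even_two_mul m).neg_one_pow]
  have h2 : (N : ℝ) ^ 2 * ((1 + 1) / (2 * (((2 * m : ℕ) : ℝ) + 1))) ≤ N / 2 := by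
    rw [← mul_div_assoc, div_le_div_iff₀ (by positivity) two_pos]
    push_cast
    nlinarith
  linarith

theorem rieszEnergy_le_of_neg {s : ℝ} (hs0 : s < 0) (hs1 : -2 < s) :
    ∃ K : ℝ, 0 < K ∧ ∀ N : ℕ, 1 ≤ N → ∀ q : Fin N → EuclideanSpace ℝ (Fin 3),
      (∀ i, ‖q i‖ = 1) →
      rieszEnergy s q ≤ Wenergy s * (N : ℝ) ^ 2 - K * (N : ℝ) ^ (1 + s / 2) := by
  set b := -s / 2 with hb
  have hb0 : 0 < b := by rw [hb]; linarith
  have hb1 : b < 1 := by rw [hb]; linarith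
  have hbb : 0 < b * (1 - b) := mul_pos hb0 (by linarith)
  refine ⟨2 ^ b * (b * (1 - b) * 4 ^ (-1 - b) / 2), by positivity, fun N hN q hq => ?_⟩
  have hN0 : (0 : ℝ) < N := by exact_mod_cast hN
  have hle : ∀ i j, inner ℝ (q i) (q j) ≤ 1 := fun i j => by
    simpa [hq] using real_inner_le_norm (q i) (q j)
  set X := ∑ i, ∑ j, (1 - inner ℝ (q i) (q j)) ^ b
  have hd : ∀ d : ℝ, 0 < d →
      ∑ i ∈ Finset.Ico N (2 * N), -binomCoeff b (2 * i) * ((1 + d)⁻¹) ^ (2 * i) * (N / 2) + X ≤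
        (N : ℝ) ^ 2 * ((2 + d) ^ (1 + b) / (2 * (1 + b))) := by
    intro d hd0
    have h1 := sum_coeff_mul_le_energy_sub_mean hq
      (a := fun k => (1 + d) ^ b * (-binomCoeff b k * ((1 + d)⁻¹) ^ k))
      (g := fun u => -(1 + d - u) ^ b)
      (fun k hk => mul_nonneg (by positivity) (mul_nonneg
        (neg_binomCoeff_nonneg hb0 hb1 hk) (by positivity)))
      (fun u hu => by
        have := (hasSum_shifted_rpow b hd0 hu).neg
        refine this.congr_fun fun k => ?_
        ring) ((Finset.Ico N (2 * N)).map ⟨fun i => 2 * i, mul_right_injective₀ two_ne_zero⟩)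
    rw [Finset.sum_map, intervalIntegral.integral_neg, integral_shifted_rpow (by linarith) d]
      at h1
    simp only [Function.Embedding.coeFn_mk, Finset.sum_neg_distrib] at h1
    have h2 : ∑ i ∈ Finset.Ico N (2 * N),
        -binomCoeff b (2 * i) * ((1 + d)⁻¹) ^ (2 * i) * (N / 2) ≤
        ∑ x ∈ Finset.Ico N (2 * N),
          (1 + d) ^ b * (-binomCoeff b (2 * x) * (1 + d)⁻¹ ^ (2 * x)) *
          (∑ i, ∑ j, (inner ℝ (q i) (q j)) ^ (2 * x) -
            (N : ℝ) ^ 2 * ∫ t in (0 : ℝ)..1, (1 - 2 * t) ^ (2 * x)) := by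
      refine Finset.sum_le_sum fun i hi => ?_
      have hNi := (Finset.mem_Ico.1 hi).1
      have h0 : 0 ≤ -binomCoeff b (2 * i) * (1 + d)⁻¹ ^ (2 * i) :=
        mul_nonneg (neg_binomCoeff_nonneg hb0 hb1 (by omega)) (by positivity)
      refine mul_le_mul ?_ (half_le_sum_inner_pow_sub hN hq hNi) (by positivity) (by positivity)
      exact le_mul_of_one_le_left h0 (Real.one_le_rpow (by linarith) hb0.le)
    have h3 : X ≤ ∑ i, ∑ j, (1 + d - inner ℝ (q i) (q j)) ^ b := by
      refine Finset.sum_le_sum fun i _ => Finset.sum_le_sum fun j _ => ?_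
      exact Real.rpow_le_rpow (by linarith [hle i j]) (by linarith) hb0.le
    have h4 : (N : ℝ) ^ 2 * (((2 + d) ^ (1 + b) - d ^ (1 + b)) / (2 * (1 + b))) ≤
        (N : ℝ) ^ 2 * ((2 + d) ^ (1 + b) / (2 * (1 + b))) := by
      have : 0 ≤ d ^ (1 + b) := by positivity
      gcongr
      linarith
    linarith
  have hlim : ∑ i ∈ Finset.Ico N (2 * N),
      -binomCoeff b (2 * i) * ((1 + (0 : ℝ))⁻¹) ^ (2 * i) * (N / 2) + X ≤
        (N : ℝ) ^ 2 * ((2 + 0) ^ (1 + b) / (2 * (1 + b))) := by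
    have hb1' : 0 ≤ 1 + b := by linarith
    refine ContinuousWithinAt.closure_le (s := Ioi (0 : ℝ)) (x := 0)
      (f := fun d => ∑ i ∈ Finset.Ico N (2 * N),
        -binomCoeff b (2 * i) * ((1 + d)⁻¹) ^ (2 * i) * (N / 2) + X)
      (g := fun d => (N : ℝ) ^ 2 * ((2 + d) ^ (1 + b) / (2 * (1 + b)))) (by simp) ?_ ?_ hd
    · refine ContinuousAt.continuousWithinAt ?_
      have : ContinuousAt (fun d : ℝ => (1 + d)⁻¹) 0 :=
        ContinuousAt.inv₀ (by fun_prop) (by norm_num)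
      fun_prop
    · refine ContinuousAt.continuousWithinAt ?_
      have : ContinuousAt (fun d : ℝ => (2 + d) ^ (1 + b)) 0 :=
        ContinuousAt.rpow_const (by fun_prop) (Or.inr hb1')
      fun_prop
  have hlow : b * (1 - b) * 4 ^ (-1 - b) / 2 * (N : ℝ) ^ (1 + s / 2) ≤
      ∑ i ∈ Finset.Ico N (2 * N),
        -binomCoeff b (2 * i) * ((1 + (0 : ℝ))⁻¹) ^ (2 * i) * (N / 2) := by
    have hterm : ∀ i ∈ Finset.Ico N (2 * N),
        b * (1 - b) * (4 * (N : ℝ)) ^ (-1 - b) * (N / 2) ≤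
        -binomCoeff b (2 * i) * ((1 + (0 : ℝ))⁻¹) ^ (2 * i) * (N / 2) := by
      intro i hi
      obtain ⟨h1, h2⟩ := Finset.mem_Ico.1 hi
      obtain ⟨j, rfl⟩ : ∃ j, i = j + 1 := ⟨i - 1, by omega⟩
      have h3 := le_neg_binomCoeff hb0 hb1 (2 * j)
      have h4 : (4 * (N : ℝ)) ^ (-1 - b) ≤ (((2 * j : ℕ) : ℝ) + 2) ^ (-1 - b) := by
        refine Real.rpow_le_rpow_of_nonpos (by positivity) ?_ (by linarith)
        have : ((j + 1 : ℕ) : ℝ) ≤ 2 * N := by exact_mod_cast h2.le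
        push_cast at this ⊢
        linarith
      have h5 := mul_le_mul_of_nonneg_left h4 hbb.le
      have : b * (1 - b) * (4 * (N : ℝ)) ^ (-1 - b) ≤ -binomCoeff b (2 * (j + 1)) := by
        rw [mul_add, mul_one]
        linarith
      simpa using mul_le_mul_of_nonneg_right this (by positivity : (0 : ℝ) ≤ N / 2)
    have := Finset.card_nsmul_le_sum _ _ _ hterm
    refine le_trans (le_of_eq ?_) this
    have hcard : 2 * N - N = N := by omega
    rw [Nat.card_Ico, hcard, nsmul_eq_mul, Real.mul_rpow (by norm_num) hN0.le]
    have h6 : (N : ℝ) ^ (1 + s / 2) = N * (N : ℝ) ^ (-1 - b) * N := by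
      rw [mul_comm (N : ℝ), ← Real.rpow_add_one hN0.ne', ← Real.rpow_add_one hN0.ne']
      congr 1
      rw [hb]; ring
    rw [h6]
    ring
  rw [rieszEnergy_eq hq, ← two_rpow_mul_eq_Wenergy]
  rw [add_zero (2 : ℝ)] at hlim
  have hX : X ≤ (N : ℝ) ^ 2 * (2 ^ (1 + b) / (2 * (1 + b))) -
      b * (1 - b) * 4 ^ (-1 - b) / 2 * (N : ℝ) ^ (1 + s / 2) := by linarith
  have := mul_le_mul_of_nonneg_left hX (by positivity : (0 : ℝ) ≤ 2 ^ b)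
  linarith

/-- The moment problem on a compact interval is determinate. -/
theorem ext_of_integral_pow_eq {μ ν : Measure ℝ} [IsProbabilityMeasure μ] [IsProbabilityMeasure ν]
    {a b : ℝ} (hμ : ∀ᵐ x ∂μ, x ∈ Icc a b) (hν : ∀ᵐ x ∂ν, x ∈ Icc a b)
    (h : ∀ n : ℕ, ∫ x, x ^ n ∂μ = ∫ x, x ^ n ∂ν) : μ = ν := by
  have hcont : ∀ {ρ : Measure ℝ} [IsProbabilityMeasure ρ], (∀ᵐ x ∂ρ, x ∈ Icc a b) →
      ∀ {f : ℝ → ℝ}, Continuous f → Integrable f ρ := by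
    intro ρ _ hρ f hf
    obtain ⟨C, hC⟩ := isCompact_Icc.exists_bound_of_continuousOn (hf.continuousOn (s := Icc a b))
    exact Integrable.of_bound hf.aestronglyMeasurable C (hρ.mono hC)
  refine ext_of_forall_integral_eq_of_IsFiniteMeasure fun g => eq_of_forall_dist_le fun ε hε => ?_
  obtain ⟨P, hP⟩ := exists_polynomial_near_of_continuousOn a b g g.continuous.continuousOn
    (ε / 2) (half_pos hε)
  have hclose : ∀ {ρ : Measure ℝ} [IsProbabilityMeasure ρ], (∀ᵐ x ∂ρ, x ∈ Icc a b) →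
      dist (∫ x, P.eval x ∂ρ) (∫ x, g x ∂ρ) ≤ ε / 2 := by
    intro ρ _ hρ
    rw [dist_eq_norm, ← integral_sub (hcont hρ P.continuous) (hcont hρ g.continuous)]
    refine (norm_integral_le_of_norm_le_const (hρ.mono fun x hx => (hP x hx).le)).trans ?_
    simp
  have hpoly : ∫ x, P.eval x ∂μ = ∫ x, P.eval x ∂ν := by
    simp_rw [Polynomial.eval_eq_sum_range]
    rw [integral_finsetSum _ fun i _ => hcont hμ (by fun_prop),
      integral_finsetSum _ fun i _ => hcont hν (by fun_prop)]
    simp_rw [integral_const_mul, h]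
  calc dist (∫ x, g x ∂μ) (∫ x, g x ∂ν)
      ≤ dist (∫ x, P.eval x ∂μ) (∫ x, g x ∂μ) + dist (∫ x, P.eval x ∂μ) (∫ x, g x ∂ν) :=
        dist_triangle_left _ _ _
    _ ≤ ε / 2 + ε / 2 := add_le_add (hclose hμ) (hpoly ▸ hclose hν)
    _ = ε := add_halves ε

/-- The theorem of Archimedes: heights on the sphere are uniformly distributed. -/
theorem map_inner_sph {x : EuclideanSpace ℝ (Fin 3)} (hx : ‖x‖ = 1) :
    squareMeasure.map (fun p => inner ℝ x (sph p)) = unitMeasure.map (fun t => 1 - 2 * t) := by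
  have hf : Continuous fun p => inner ℝ x (sph p) := continuous_const.inner continuous_sph
  have hg : Continuous fun t : ℝ => 1 - 2 * t := by fun_prop
  have := Measure.isProbabilityMeasure_map (μ := squareMeasure) hf.aemeasurable
  have := Measure.isProbabilityMeasure_map (μ := unitMeasure) hg.aemeasurable
  refine ext_of_integral_pow_eq (a := -1) (b := 1) ?_ ?_ fun n => ?_
  · refine (ae_map_iff hf.aemeasurable measurableSet_Icc).2 ?_
    filter_upwards [ae_squareMeasure] with p hp
    have := abs_real_inner_le_norm x (sph p)
    rw [hx, norm_sph hp.1.le hp.2.le, one_mul] at this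
    exact abs_le.1 this
  · refine (ae_map_iff hg.aemeasurable measurableSet_Icc).2 ?_
    filter_upwards [ae_restrict_mem measurableSet_Ioc] with t ht
    exact ⟨by linarith [ht.2], by linarith [ht.1]⟩
  · rw [integral_map hf.aemeasurable (by fun_prop), integral_map hg.aemeasurable (by fun_prop),
      integral_inner_sph_pow hx, integral_unitMeasure]

theorem measurable_kernel (s : ℝ) :
    Measurable fun z : (ℝ × ℝ) × (ℝ × ℝ) => ‖sph z.1 - sph z.2‖ ^ (-s) := by
  have := continuous_sph.measurable
  fun_prop

theorem integrable_potential {s : ℝ} (hs2 : s < 2) {x : EuclideanSpace ℝ (Fin 3)} (hx : ‖x‖ = 1) :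
    Integrable (fun p => ‖x - sph p‖ ^ (-s)) squareMeasure ∧
      ∫ p, ‖x - sph p‖ ^ (-s) ∂squareMeasure = Wenergy s := by
  have hb : -1 < -s / 2 := by linarith
  set h : ℝ → ℝ := fun t => 2 ^ (-s / 2) * (1 - t) ^ (-s / 2) with hh
  have hm : Measurable h := by fun_prop
  have hf : Continuous fun p => inner ℝ x (sph p) := continuous_const.inner continuous_sph
  have hg : Continuous fun t : ℝ => 1 - 2 * t := by fun_prop
  have hae : (fun p => h (inner ℝ x (sph p))) =ᵐ[squareMeasure] fun p => ‖x - sph p‖ ^ (-s) := by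
    filter_upwards [ae_squareMeasure] with p hp
    rw [norm_sub_rpow hx (norm_sph hp.1.le hp.2.le)]
  have hint : Integrable (fun t => h (1 - 2 * t)) unitMeasure := by
    have : IntervalIntegrable (fun t : ℝ => 2 ^ (-s / 2) * (2 * t) ^ (-s / 2)) volume 0 1 := by
      have := (intervalIntegral.intervalIntegrable_rpow' (a := 0) (b := 2) hb).comp_mul_left (c := 2)
      simpa using this.const_mul _
    have h1 := this.1
    simp only [hh, sub_sub_cancel]
    exact h1
  constructor
  · refine Integrable.congr ?_ hae
    rw [← Function.comp_def h, ← integrable_map_measure hm.aestronglyMeasurable hf.aemeasurable,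
      map_inner_sph hx, integrable_map_measure hm.aestronglyMeasurable hg.aemeasurable]
    exact hint
  · rw [← integral_congr_ae hae, ← integral_map hf.aemeasurable hm.aestronglyMeasurable,
      map_inner_sph hx, integral_map hg.aemeasurable hm.aestronglyMeasurable,
      integral_unitMeasure, ← two_rpow_mul_eq_Wenergy]
    simp only [hh]
    have := integral_shifted_rpow hb 0
    rw [add_zero, add_zero, Real.zero_rpow (by linarith), sub_zero] at this
    rw [intervalIntegral.integral_const_mul, this]

theorem integrable_kernel {s : ℝ} (hs2 : s < 2) :
    Integrable (fun z : (ℝ × ℝ) × (ℝ × ℝ) => ‖sph z.1 - sph z.2‖ ^ (-s))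
      (squareMeasure.prod squareMeasure) := by
  rw [integrable_prod_iff (measurable_kernel s).aestronglyMeasurable]
  constructor
  · filter_upwards [ae_squareMeasure] with p hp
    exact (integrable_potential hs2 (norm_sph hp.1.le hp.2.le)).1
  · refine (integrable_const (Wenergy s)).congr ?_
    filter_upwards [ae_squareMeasure] with p hp
    rw [← (integrable_potential hs2 (norm_sph hp.1.le hp.2.le)).2]
    refine integral_congr_ae (Filter.Eventually.of_forall fun p' => ?_)
    simp only
    rw [Real.norm_of_nonneg (by positivity)]

theorem integral_kernel {s : ℝ} (hs2 : s < 2) :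
    ∫ z : (ℝ × ℝ) × (ℝ × ℝ), ‖sph z.1 - sph z.2‖ ^ (-s) ∂(squareMeasure.prod squareMeasure) =
      Wenergy s := by
  rw [integral_prod _ (integrable_kernel hs2)]
  have : (fun p => ∫ p', ‖sph p - sph p'‖ ^ (-s) ∂squareMeasure) =ᵐ[squareMeasure]
      fun _ => Wenergy s := by
    filter_upwards [ae_squareMeasure] with p hp
    exact (integrable_potential hs2 (norm_sph hp.1.le hp.2.le)).2
  rw [integral_congr_ae this]
  simp

theorem measurePreserving_eval_pair {ι Ω : Type*} [Fintype ι] [MeasurableSpace Ω]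
    (ρ : ι → Measure Ω) [∀ i, IsProbabilityMeasure (ρ i)] {i j : ι} (hij : i ≠ j) :
    MeasurePreserving (fun ω : ι → Ω => (ω i, ω j)) (Measure.pi ρ) ((ρ i).prod (ρ j)) := by
  refine ⟨by fun_prop, ?_⟩
  have h := (iIndepFun_pi (μ := ρ) (X := fun _ x => x) fun _ => aemeasurable_id').indepFun hij
  have := h.map_prod_eq_prod_map_map (measurable_pi_apply i).aemeasurable
    (measurable_pi_apply j).aemeasurable
  rw [this]
  congr 1
  · exact (measurePreserving_eval ρ i).map_eq
  · exact (measurePreserving_eval ρ j).map_eq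

/-- Choosing the points independently, some outcome is at most as large as the average. -/
theorem exists_sum_le_sum_integral {ι Ω : Type*} [Fintype ι] [DecidableEq ι] [MeasurableSpace Ω]
    (ρ : ι → Measure Ω) [∀ i, IsProbabilityMeasure (ρ i)] {k : Ω × Ω → ℝ}
    (hk : ∀ i j, Integrable k ((ρ i).prod (ρ j))) {D : ι → Set Ω} (hD : ∀ i, ∀ᵐ x ∂ρ i, x ∈ D i) :
    ∃ ω : ι → Ω, (∀ i, ω i ∈ D i) ∧ ∑ i, ∑ j, (if i = j then 0 else k (ω i, ω j)) ≤
      ∑ i, ∑ j, if i = j then 0 else ∫ z, k z ∂((ρ i).prod (ρ j)) := by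
  have hint : ∀ i j, Integrable (fun ω : ι → Ω => if i = j then 0 else k (ω i, ω j))
      (Measure.pi ρ) := by
    intro i j
    split_ifs with h
    · exact integrable_zero _ _ _
    · exact (measurePreserving_eval_pair ρ h).integrable_comp_of_integrable (hk i j)
  have hval : ∀ i j, ∫ ω : ι → Ω, (if i = j then 0 else k (ω i, ω j)) ∂(Measure.pi ρ) =
      if i = j then 0 else ∫ z, k z ∂((ρ i).prod (ρ j)) := by
    intro i j
    split_ifs with h
    · simp
    · have hp := measurePreserving_eval_pair ρ h
      rw [← hp.map_eq, integral_map hp.measurable.aemeasurable]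
      rw [hp.map_eq]
      exact (hk i j).aestronglyMeasurable
  have hae : ∀ᵐ ω ∂(Measure.pi ρ), ∀ i, ω i ∈ D i :=
    ae_all_iff.2 fun i => (Measure.quasiMeasurePreserving_eval ρ i).ae (hD i)
  obtain ⟨ω, hω, hle⟩ := exists_notMem_null_le_integral
    (integrable_finsetSum Finset.univ fun i _ => integrable_finsetSum Finset.univ fun j _ =>
      hint i j) (ae_iff.1 hae)
  refine ⟨ω, by simpa using hω, hle.trans (le_of_eq ?_)⟩
  rw [integral_finsetSum _ fun i _ => integrable_finsetSum _ fun j _ => hint i j]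
  refine Finset.sum_congr rfl fun i _ => ?_
  rw [integral_finsetSum _ fun j _ => hint i j]
  exact Finset.sum_congr rfl fun j _ => hval i j

theorem ae_mem_iUnion {ι Ω : Type*} [Fintype ι] [Nonempty ι] [MeasurableSpace Ω] {μ : Measure Ω}
    [IsProbabilityMeasure μ] {D : ι → Set Ω} (hm : ∀ i, MeasurableSet (D i))
    (hd : Pairwise (Function.onFun Disjoint D)) (hμ : ∀ i, μ (D i) = (Fintype.card ι : ENNReal)⁻¹) :
    ∀ᵐ x ∂μ, x ∈ ⋃ i, D i := by
  refine (mem_ae_iff_prob_eq_one (MeasurableSet.iUnion hm)).2 ?_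
  rw [measure_iUnion hd hm, tsum_fintype]
  simp only [hμ, Finset.sum_const, Finset.card_univ, nsmul_eq_mul]
  exact ENNReal.mul_inv_cancel (by simp) (by simp)

theorem exists_energy_le {ι Ω : Type*} [Fintype ι] [Nonempty ι] [DecidableEq ι]
    [MeasurableSpace Ω] {μ : Measure Ω} [IsProbabilityMeasure μ] {D : ι → Set Ω}
    (hm : ∀ i, MeasurableSet (D i)) (hd : Pairwise (Function.onFun Disjoint D))
    (hμ : ∀ i, μ (D i) = (Fintype.card ι : ENNReal)⁻¹) {k : Ω × Ω → ℝ}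
    (hk : Integrable k (μ.prod μ)) {L : Ω → ℝ} (hL : Integrable L μ)
    (hLk : ∀ i, ∀ᵐ z ∂(μ.prod μ), z ∈ D i ×ˢ D i → L z.1 ≤ k z) :
    ∃ ω : ι → Ω, (∀ i, ω i ∈ D i) ∧ ∑ i, ∑ j, (if i = j then 0 else k (ω i, ω j)) ≤
      (Fintype.card ι : ℝ) ^ 2 * ∫ z, k z ∂(μ.prod μ) - Fintype.card ι * ∫ x, L x ∂μ := by
  set N : ℝ := (Fintype.card ι : ℝ) with hN
  have hN0 : 0 < N := by rw [hN]; exact_mod_cast Fintype.card_pos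
  have hne : ∀ i, μ (D i) ≠ 0 := fun i => by rw [hμ]; simp
  have : ∀ i, IsProbabilityMeasure (μ[|D i]) := fun i => cond_isProbabilityMeasure (hne i)
  have hprod : ∀ i j, (μ[|D i]).prod (μ[|D j]) =
      (Fintype.card ι : ENNReal) • (Fintype.card ι : ENNReal) •
        (μ.prod μ).restrict (D i ×ˢ D j) := by
    intro i j
    rw [ProbabilityTheory.cond, ProbabilityTheory.cond, hμ, hμ, inv_inv, Measure.prod_smul_left, Measure.prod_smul_right,
      Measure.prod_restrict]
  have hval : ∀ i j, ∫ z, k z ∂((μ[|D i]).prod (μ[|D j])) =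
      N ^ 2 * ∫ z in D i ×ˢ D j, k z ∂(μ.prod μ) := by
    intro i j
    rw [hprod, integral_smul_measure, integral_smul_measure]
    simp [hN]
    ring
  obtain ⟨ω, hω, hle⟩ := exists_sum_le_sum_integral (fun i => μ[|D i]) (k := k)
    (fun i j => by
      rw [hprod]
      exact (hk.restrict.smul_measure (by simp)).smul_measure (by simp))
    (D := D) (fun i => ae_cond_mem (hm i))
  refine ⟨ω, hω, hle.trans ?_⟩
  have hsum : ∑ i, ∑ j, ∫ z in D i ×ˢ D j, k z ∂(μ.prod μ) = ∫ z, k z ∂(μ.prod μ) := by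
    rw [← Fintype.sum_prod_type' (fun i j => ∫ z in D i ×ˢ D j, k z ∂(μ.prod μ)),
      ← integral_iUnion_fintype (s := fun x : ι × ι => D x.1 ×ˢ D x.2)
        (fun x => (hm x.1).prod (hm x.2)) ?_ fun x => hk.integrableOn]
    · rw [Measure.restrict_eq_self_of_ae_mem]
      have h := ae_mem_iUnion hm hd hμ
      filter_upwards [Measure.quasiMeasurePreserving_fst.ae h,
        Measure.quasiMeasurePreserving_snd.ae h] with z h1 h2
      obtain ⟨i, hi⟩ := mem_iUnion.1 h1
      obtain ⟨j, hj⟩ := mem_iUnion.1 h2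
      exact mem_iUnion.2 ⟨(i, j), hi, hj⟩
    · rintro ⟨i, j⟩ ⟨i', j'⟩ hne
      rw [Function.onFun, Set.disjoint_prod]
      by_cases h : i = i'
      · exact Or.inr (hd fun h' => hne (Prod.ext h h'))
      · exact Or.inl (hd h)
  have hdiag : ∀ i, N⁻¹ * ∫ x in D i, L x ∂μ ≤ ∫ z in D i ×ˢ D i, k z ∂(μ.prod μ) := by
    intro i
    have h1 : ∫ z in D i ×ˢ D i, L z.1 ∂(μ.prod μ) = N⁻¹ * ∫ x in D i, L x ∂μ := by
      have := setIntegral_prod_mul (μ := μ) (ν := μ) L (fun _ => (1 : ℝ)) (D i) (D i)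
      simp only [mul_one] at this
      rw [this, setIntegral_const, measureReal_def, hμ]
      simp [hN, mul_comm]
    rw [← h1]
    refine setIntegral_mono_ae_restrict ?_ hk.integrableOn ?_
    · exact (hL.comp_fst μ).integrableOn
    · rw [Filter.EventuallyLE, ae_restrict_iff' ((hm i).prod (hm i))]
      exact hLk i
  have hLsum : ∑ i, ∫ x in D i, L x ∂μ = ∫ x, L x ∂μ := by
    rw [← integral_iUnion_fintype hm hd fun i => hL.integrableOn,
      Measure.restrict_eq_self_of_ae_mem (ae_mem_iUnion hm hd hμ)]
  have hsplit : ∑ i, ∑ j, (if i = j then 0 else N ^ 2 * ∫ z in D i ×ˢ D j, k z ∂(μ.prod μ)) =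
      N ^ 2 * ∑ i, ∑ j, ∫ z in D i ×ˢ D j, k z ∂(μ.prod μ) -
        N ^ 2 * ∑ i, ∫ z in D i ×ˢ D i, k z ∂(μ.prod μ) := by
    rw [← mul_sub, ← Finset.sum_sub_distrib, Finset.mul_sum]
    refine Finset.sum_congr rfl fun i _ => ?_
    have h1 := Finset.sum_ite_eq Finset.univ i
      (fun j => N ^ 2 * ∫ z in D i ×ˢ D j, k z ∂(μ.prod μ))
    rw [if_pos (Finset.mem_univ i)] at h1
    rw [mul_sub, Finset.mul_sum, ← h1, ← Finset.sum_sub_distrib]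
    exact Finset.sum_congr rfl fun j _ => by split_ifs <;> simp
  simp_rw [hval]
  rw [hsplit, hsum]
  have h2 : N * ∫ x, L x ∂μ ≤ N ^ 2 * ∑ i, ∫ z in D i ×ˢ D i, k z ∂(μ.prod μ) := by
    calc N * ∫ x, L x ∂μ = N ^ 2 * ∑ i, N⁻¹ * ∫ x in D i, L x ∂μ := by
          rw [← Finset.mul_sum, hLsum]; field_simp
      _ ≤ _ := by gcongr with i; exact hdiag i
  linarith

theorem norm_sph_sub_sph_sq {p p' : ℝ × ℝ} (hp : p.1 ∈ Icc (0 : ℝ) 1) (hp' : p'.1 ∈ Icc (0 : ℝ) 1) :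
    ‖sph p - sph p'‖ ^ 2 =
      (√(4 * p.1 * (1 - p.1)) - √(4 * p'.1 * (1 - p'.1))) ^ 2 + 4 * (p.1 - p'.1) ^ 2 +
      2 * (√(4 * p.1 * (1 - p.1)) * √(4 * p'.1 * (1 - p'.1))) *
        (1 - Real.cos (2 * Real.pi * p.2 - 2 * Real.pi * p'.2)) := by
  rw [norm_sub_sq_real, norm_sph hp.1 hp.2, norm_sph hp'.1 hp'.2, inner_sph, Real.cos_sub]
  have h1 := Real.sq_sqrt (mul_nonneg (mul_nonneg zero_le_four hp.1) (sub_nonneg.2 hp.2))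
  have h2 := Real.sq_sqrt (mul_nonneg (mul_nonneg zero_le_four hp'.1) (sub_nonneg.2 hp'.2))
  simp [sph]
  linear_combination -h1 - h2

theorem norm_sph_sub_sph_sq_mul_le {p p' : ℝ × ℝ} (hp : p.1 ∈ Ioo (0 : ℝ) 1)
    (hp' : p'.1 ∈ Ioo (0 : ℝ) 1) :
    ‖sph p - sph p'‖ ^ 2 * (p.1 * (1 - p.1)) ≤ 8 * (p.1 - p'.1) ^ 2 + 64 * (p.2 - p'.2) ^ 2 := by
  rw [norm_sph_sub_sph_sq (Ioo_subset_Icc_self hp) (Ioo_subset_Icc_self hp')]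
  obtain ⟨ha0, ha1⟩ := hp
  obtain ⟨ha0', ha1'⟩ := hp'
  set a := p.1
  set a' := p'.1
  have hw0 : 0 < a * (1 - a) := mul_pos ha0 (by linarith)
  have hw0' : 0 < a' * (1 - a') := mul_pos ha0' (by linarith)
  have hw1 : a * (1 - a) ≤ 1 / 4 := by nlinarith [sq_nonneg (a - 1 / 2)]
  have hw1' : a' * (1 - a') ≤ 1 / 4 := by nlinarith [sq_nonneg (a' - 1 / 2)]
  set r := √(4 * a * (1 - a)) with hr
  set r' := √(4 * a' * (1 - a')) with hr'
  have hr2 : r ^ 2 = 4 * (a * (1 - a)) := by rw [hr, Real.sq_sqrt (by linarith)]; ring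
  have hr2' : r' ^ 2 = 4 * (a' * (1 - a')) := by rw [hr', Real.sq_sqrt (by linarith)]; ring
  have hr0 : 0 ≤ r := Real.sqrt_nonneg _
  have hr0' : 0 ≤ r' := Real.sqrt_nonneg _
  have hr1 : r ≤ 1 := by nlinarith
  have hr1' : r' ≤ 1 := by nlinarith
  have h1 : (r - r') ^ 2 * (a * (1 - a)) ≤ 4 * (a - a') ^ 2 := by
    have h2 : ((r - r') * r) ^ 2 ≤ ((r - r') * (r + r')) ^ 2 := by
      rw [mul_pow, mul_pow]
      exact mul_le_mul_of_nonneg_left (pow_le_pow_left₀ hr0 (by linarith) 2) (sq_nonneg _)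
    have h3 : (r - r') * (r + r') = 4 * ((a - a') * (1 - a - a')) := by
      linear_combination hr2 - hr2'
    rw [h3] at h2
    have h4 : ((a - a') * (1 - a - a')) ^ 2 ≤ (a - a') ^ 2 := by
      rw [mul_pow]
      refine mul_le_of_le_one_right (sq_nonneg _) ?_
      nlinarith
    have h5 : ((r - r') * r) ^ 2 = 4 * ((r - r') ^ 2 * (a * (1 - a))) := by
      rw [mul_pow, hr2]; ring
    nlinarith
  have h2 : 2 * (r * r') * (1 - Real.cos (2 * Real.pi * p.2 - 2 * Real.pi * p'.2)) ≤
      64 * (p.2 - p'.2) ^ 2 := by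
    have hc := Real.one_sub_sq_div_two_le_cos (x := 2 * Real.pi * p.2 - 2 * Real.pi * p'.2)
    have hc1 := Real.cos_le_one (2 * Real.pi * p.2 - 2 * Real.pi * p'.2)
    have hrr : r * r' ≤ 1 := mul_le_one₀ hr1 hr0' hr1'
    have hpi : Real.pi ^ 2 ≤ 16 := by nlinarith [Real.pi_pos, Real.pi_lt_four]
    have h3 : r * r' * (1 - Real.cos (2 * Real.pi * p.2 - 2 * Real.pi * p'.2)) ≤
        1 - Real.cos (2 * Real.pi * p.2 - 2 * Real.pi * p'.2) :=
      mul_le_of_le_one_left (by linarith) hrr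
    have h4 : (2 * Real.pi * p.2 - 2 * Real.pi * p'.2) ^ 2 =
        4 * (Real.pi ^ 2 * (p.2 - p'.2) ^ 2) := by ring
    have h5 := mul_le_mul_of_nonneg_right hpi (sq_nonneg (p.2 - p'.2))
    linarith
  have h3 : 0 ≤ 2 * (r * r') * (1 - Real.cos (2 * Real.pi * p.2 - 2 * Real.pi * p'.2)) :=
    mul_nonneg (by positivity) (by linarith [Real.cos_le_one (2 * Real.pi * p.2 - 2 * Real.pi * p'.2)])
  have h4 := mul_le_of_le_one_right h3 (by linarith : a * (1 - a) ≤ 1)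
  have h5 := mul_le_of_le_one_right (by positivity : 0 ≤ 4 * (a - a') ^ 2)
    (by linarith : a * (1 - a) ≤ 1)
  rw [add_mul, add_mul]
  linarith

theorem injOn_sph : InjOn sph (Ioo 0 1 ×ˢ Ioc 0 1) := by
  rintro ⟨a, b⟩ ⟨⟨ha0, ha1⟩, hb0, hb1⟩ ⟨a', b'⟩ ⟨⟨ha0', ha1'⟩, hb0', hb1'⟩ h
  simp only at ha0 ha1 hb0 hb1 ha0' ha1' hb0' hb1'
  have h2 : (1 : ℝ) - 2 * a = 1 - 2 * a' := congrArg (fun v : EuclideanSpace ℝ (Fin 3) => v 2) h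
  obtain rfl : a = a' := by linarith
  have h3 := norm_sph_sub_sph_sq (p := (a, b)) (p' := (a, b')) ⟨ha0.le, ha1.le⟩ ⟨ha0.le, ha1.le⟩
  have hw : 0 < 4 * a * (1 - a) := mul_pos (by linarith) (by linarith)
  rw [h] at h3
  simp only [sub_self, norm_zero, Real.mul_self_sqrt hw.le] at h3
  have h4 : Real.cos (2 * Real.pi * b - 2 * Real.pi * b') = 1 := by
    have : 2 * (4 * a * (1 - a)) * (1 - Real.cos (2 * Real.pi * b - 2 * Real.pi * b')) = 0 := by
      linarith
    linarith [(mul_eq_zero.1 this).resolve_left (by positivity)]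
  have hpi := Real.pi_pos
  rw [Real.cos_eq_one_iff_of_lt_of_lt (by nlinarith) (by nlinarith), ← mul_sub] at h4
  have := (mul_eq_zero.1 h4).resolve_left (by positivity)
  rw [Prod.mk.injEq]
  exact ⟨rfl, by linarith⟩

theorem integrable_weight_rpow {r : ℝ} (hr : -1 < r) :
    Integrable (fun a : ℝ => (a * (1 - a)) ^ r) unitMeasure := by
  have h0 : 0 < ((r + 1 : ℝ) : ℂ).re := by rw [Complex.ofReal_re]; linarith
  have h : IntegrableOn _ (Ioc (0 : ℝ) 1) := (Complex.betaIntegral_convergent h0 h0).1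
  have h1 : Integrable _ unitMeasure := h.norm
  refine h1.congr ?_
  have hae : ∀ᵐ a ∂unitMeasure, a ∈ Ioo (0 : ℝ) 1 := by
    rw [unitMeasure, ← restrict_Ioo_eq_restrict_Ioc]
    exact ae_restrict_mem measurableSet_Ioo
  filter_upwards [hae] with a ha
  have ha1 : 0 < 1 - a := sub_pos.2 ha.2
  have : (1 - (a : ℂ)) = ((1 - a : ℝ) : ℂ) := by push_cast; ring
  rw [norm_mul, this, Complex.norm_cpow_eq_rpow_re_of_pos ha.1,
    Complex.norm_cpow_eq_rpow_re_of_pos ha1, Real.mul_rpow ha.1.le ha1.le]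
  simp

theorem integral_weight_rpow_pos {r : ℝ} (hr : -1 < r) :
    0 < ∫ a, (a * (1 - a)) ^ r ∂unitMeasure := by
  rw [integral_unitMeasure]
  refine intervalIntegral.intervalIntegral_pos_of_pos_on ?_ (fun a ha => ?_) zero_lt_one
  · rw [intervalIntegrable_iff_integrableOn_Ioc_of_le zero_le_one]
    exact integrable_weight_rpow hr
  · exact Real.rpow_pos_of_pos (mul_pos ha.1 (sub_pos.2 ha.2)) _

/-- The unit square can be cut into `N` boxes of equal area whose sides are of order `N ^ (-1/2)`. -/
theorem exists_partition {N : ℕ} (hN : 1 ≤ N) : ∃ D : Fin N → Set (ℝ × ℝ),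
    (∀ i, MeasurableSet (D i)) ∧ Pairwise (Function.onFun Disjoint D) ∧
    (∀ i, squareMeasure (D i) = (N : ENNReal)⁻¹) ∧ (∀ i, D i ⊆ Ioo 0 1 ×ˢ Ioc 0 1) ∧
    ∀ i, ∀ p ∈ D i, ∀ p' ∈ D i,
      8 * (p.1 - p'.1) ^ 2 + 64 * (p.2 - p'.2) ^ 2 ≤ 408 / N := by
  obtain ⟨l, hl⟩ : ∃ l, Nat.sqrt N = l + 1 :=
    Nat.exists_eq_succ_of_ne_zero (Nat.sqrt_pos.2 hN).ne'
  obtain ⟨e, he⟩ : ∃ e, N = (l + 1) * (l + 1) + e :=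
    Nat.exists_eq_add_of_le (hl ▸ Nat.sqrt_le N)
  have hle : e ≤ 2 * (l + 1) := by
    have := Nat.sqrt_le_add N
    rw [hl] at this
    omega
  set m := l + 1 with hm
  let n : Fin m → ℕ := fun i => m + if i = Fin.last l then e else 0
  have hn1 : ∀ i, m ≤ n i := fun i => Nat.le_add_right _ _
  have hn0 : ∀ i, 0 < n i := fun i => lt_of_lt_of_le (Nat.succ_pos l) (hn1 i)
  have hn3 : ∀ i, n i ≤ 3 * m := fun i => by
    simp only [n]; split_ifs <;> omega
  have hnN : ∀ i : Fin m, m * i + n i ≤ N := by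
    intro i
    simp only [n]
    split_ifs with h
    · subst h
      rw [Fin.val_last, he, hm]
      linarith
    · have : (i : ℕ) + 1 ≤ m := i.2
      have := Nat.mul_le_mul_left m this
      rw [he]
      linarith
  have hstep : ∀ i i' : Fin m, i < i' → m * (i : ℕ) + n i ≤ m * i' := by
    intro i i' h
    have h1 : i ≠ Fin.last l := fun h' => by
      subst h'
      exact absurd (Fin.le_last i') (not_le.2 h)
    simp only [n, if_neg h1]
    have : (i : ℕ) + 1 ≤ i' := h
    have := Nat.mul_le_mul_left m this
    linarith
  have hcard : Fintype.card (Σ i : Fin m, Fin (n i)) = N := by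
    rw [Fintype.card_sigma]
    simp only [Fintype.card_fin, n, Finset.sum_add_distrib, Finset.sum_ite_eq', Finset.mem_univ,
      if_true, Finset.sum_const, Finset.card_univ, smul_eq_mul]
    exact he.symm
  have hN0 : (0 : ℝ) < N := by exact_mod_cast hN
  have hm0 : (0 : ℝ) < m := by exact_mod_cast Nat.succ_pos l
  have hn0' : ∀ i, (0 : ℝ) < n i := fun i => by exact_mod_cast hn0 i
  let A : Fin m → Set ℝ := fun i => Ioo ((m * i : ℝ) / N) ((m * i + n i : ℝ) / N)
  let B : ∀ i : Fin m, Fin (n i) → Set ℝ := fun i j => Ioc ((j : ℝ) / n i) ((j + 1 : ℝ) / n i)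
  have hA : ∀ i, A i ⊆ Ioo 0 1 := by
    intro i
    refine Ioo_subset_Ioo (by positivity) ((div_le_one hN0).2 ?_)
    exact_mod_cast hnN i
  have hB : ∀ i j, B i j ⊆ Ioc 0 1 := by
    intro i j
    refine Ioc_subset_Ioc (by positivity) ((div_le_one (hn0' i)).2 ?_)
    exact_mod_cast j.2
  have hAd : ∀ i i', i ≠ i' → Disjoint (A i) (A i') := by
    have key : ∀ i i', i < i' → Disjoint (A i) (A i') := by
      intro i i' h
      refine Set.disjoint_left.2 fun a ha ha' => absurd (ha'.1.trans ha.2) (not_lt.2 ?_)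
      have : (m * i + n i : ℝ) ≤ m * i' := by exact_mod_cast hstep i i' h
      gcongr
    intro i i' h
    rcases lt_or_gt_of_ne h with h | h
    · exact key i i' h
    · exact (key i' i h).symm
  have hBd : ∀ i j j', j ≠ j' → Disjoint (B i j) (B i j') := by
    have key : ∀ i j j', j < j' → Disjoint (B i j) (B i j') := by
      intro i j j' h
      refine Set.disjoint_left.2 fun b hb hb' => absurd (hb'.1.trans_le hb.2) (not_lt.2 ?_)
      have : (j + 1 : ℝ) ≤ j' := by exact_mod_cast (h : (j : ℕ) < j')
      have := hn0' i
      gcongr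
    intro i j j' h
    rcases lt_or_gt_of_ne h with h | h
    · exact key i j j' h
    · exact (key i j' j h).symm
  have hAm : ∀ i, unitMeasure (A i) = ENNReal.ofReal (n i / N) := by
    intro i
    rw [unitMeasure, Measure.restrict_eq_self _ ((hA i).trans Ioo_subset_Ioc_self), Real.volume_Ioo]
    congr 1
    ring
  have hBm : ∀ i j, unitMeasure (B i j) = ENNReal.ofReal (1 / n i) := by
    intro i j
    rw [unitMeasure, Measure.restrict_eq_self _ (hB i j), Real.volume_Ioc]
    congr 1
    ring
  let φ : Fin N ≃ Σ i : Fin m, Fin (n i) := (Fintype.equivFinOfCardEq hcard).symm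
  refine ⟨fun x => A (φ x).1 ×ˢ B (φ x).1 (φ x).2, fun x => measurableSet_Ioo.prod measurableSet_Ioc,
    fun x y hxy => ?_, fun x => ?_, fun x => Set.prod_mono (hA _) (hB _ _), ?_⟩
  · have hne : φ x ≠ φ y := fun h => hxy (φ.injective h)
    rw [Function.onFun, Set.disjoint_prod]
    generalize φ x = u at hne
    generalize φ y = v at hne
    obtain ⟨i, j⟩ := u
    obtain ⟨i', j'⟩ := v
    by_cases h : i = i'
    · subst h
      exact Or.inr (hBd i j j' fun h => hne (by rw [h]))
    · exact Or.inl (hAd i i' h)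
  · rw [squareMeasure, Measure.prod_prod, hAm, hBm, ← ENNReal.ofReal_mul (by positivity)]
    have := (hn0' (φ x).1).ne'
    rw [show (n (φ x).1 / N * (1 / n (φ x).1) : ℝ) = (N : ℝ)⁻¹ by field_simp,
      ENNReal.ofReal_inv_of_pos hN0, ENNReal.ofReal_natCast]
  · rintro x ⟨a, b⟩ ⟨ha, hb⟩ ⟨a', b'⟩ ⟨ha', hb'⟩
    generalize φ x = u at *
    obtain ⟨i, j⟩ := u
    simp only [A, B, mem_Ioo, mem_Ioc] at ha hb ha' hb' ⊢
    have hNle : (N : ℝ) ≤ 3 * m ^ 2 := by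
      have : N ≤ 3 * m ^ 2 := by rw [he]; nlinarith
      exact_mod_cast this
    have hmN : (m : ℝ) ^ 2 ≤ N := by
      have : m ^ 2 ≤ N := by rw [he, sq]; exact Nat.le_add_right _ _
      exact_mod_cast this
    have h1 : |a - a'| ≤ 3 / m := by
      have h2 : (n i : ℝ) / N ≤ 3 / m := by
        have : (n i : ℝ) ≤ 3 * m := by exact_mod_cast hn3 i
        rw [div_le_div_iff₀ hN0 hm0]
        nlinarith
      rw [add_div] at ha ha'
      exact abs_le.2 ⟨by linarith, by linarith⟩
    have h2 : |b - b'| ≤ 1 / m := by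
      have h3 : (1 : ℝ) / n i ≤ 1 / m :=
        one_div_le_one_div_of_le hm0 (by exact_mod_cast hn1 i)
      rw [add_div] at hb hb'
      exact abs_le.2 ⟨by linarith, by linarith⟩
    have h3 : (a - a') ^ 2 ≤ (3 / m) ^ 2 := sq_le_sq' (abs_le.1 h1).1 (abs_le.1 h1).2
    have h4 : (b - b') ^ 2 ≤ (1 / m) ^ 2 := sq_le_sq' (abs_le.1 h2).1 (abs_le.1 h2).2
    have h5 : (136 : ℝ) / m ^ 2 ≤ 408 / N := by
      rw [div_le_div_iff₀ (by positivity) hN0]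
      linarith
    have h6 : 8 * (3 / (m : ℝ)) ^ 2 + 64 * (1 / m) ^ 2 = 136 / m ^ 2 := by ring
    linarith

theorem ae_fst_ne : ∀ᵐ z ∂(squareMeasure.prod squareMeasure), z.1.1 ≠ z.2.1 := by
  have hm : MeasurableSet {z : (ℝ × ℝ) × (ℝ × ℝ) | z.1.1 ≠ z.2.1} :=
    (measurableSet_eq_fun (by fun_prop) (by fun_prop)).compl
  refine (Measure.ae_prod_mem_iff_ae_ae_mem hm).2 (Filter.Eventually.of_forall fun p => ?_)
  have h : ∀ᵐ a ∂unitMeasure, p.1 ≠ a := by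
    have := ae_restrict_of_ae (s := Ioc (0 : ℝ) 1) (Measure.ae_ne volume p.1)
    filter_upwards [this] with a ha using ha.symm
  exact Measure.quasiMeasurePreserving_fst.ae h

theorem one_div_mul_rpow_le {s x y : ℝ} (hs : s ≠ 0) (hx : 0 < x) (hxy : x ^ 2 ≤ y) :
    1 / s * y ^ (-s / 2) ≤ 1 / s * x ^ (-s) := by
  have h : x ^ (-s) = (x ^ 2) ^ (-s / 2) := by
    rw [← Real.rpow_natCast_mul hx.le]
    congr 1
    push_cast
    ring
  rw [h]
  rcases lt_or_gt_of_ne hs with hs | hs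
  · exact mul_le_mul_of_nonpos_left (Real.rpow_le_rpow (by positivity) hxy (by linarith))
      (one_div_neg.2 hs).le
  · exact mul_le_mul_of_nonneg_left
      (Real.rpow_le_rpow_of_nonpos (by positivity) hxy (by linarith)) (by positivity)

theorem exists_rieszEnergy_le {s : ℝ} (hs1 : -2 < s) (hs2 : s < 2) (hs0 : s ≠ 0) :
    ∃ K : ℝ, 0 < K ∧ ∀ N : ℕ, 1 ≤ N → ∃ q : Fin N → EuclideanSpace ℝ (Fin 3),
      (∀ i, ‖q i‖ = 1) ∧ Function.Injective q ∧
      1 / s * rieszEnergy s q ≤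
        1 / s * (Wenergy s * (N : ℝ) ^ 2 - K * (N : ℝ) ^ (1 + s / 2)) := by
  have hr : -1 < s / 2 := by linarith
  have hI := integral_weight_rpow_pos hr
  set I := ∫ a, (a * (1 - a)) ^ (s / 2) ∂unitMeasure
  refine ⟨408 ^ (-s / 2) * I, by positivity, fun N hN => ?_⟩
  have hN0 : (0 : ℝ) < N := by exact_mod_cast hN
  have : Nonempty (Fin N) := ⟨⟨0, hN⟩⟩
  obtain ⟨D, hm, hd, hμ, hsub, hdiam⟩ := exists_partition hN
  have hL : Integrable
      (fun p : ℝ × ℝ => 1 / s * ((408 / N) ^ (-s / 2) * (p.1 * (1 - p.1)) ^ (s / 2)))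
      squareMeasure :=
    (((integrable_weight_rpow hr).comp_fst unitMeasure).const_mul _).const_mul _
  obtain ⟨ω, hω, hle⟩ := exists_energy_le hm hd (by simpa using hμ)
    (k := fun z => 1 / s * ‖sph z.1 - sph z.2‖ ^ (-s)) ((integrable_kernel hs2).const_mul _) hL
    (fun i => by
      filter_upwards [ae_fst_ne] with ⟨p, p'⟩ hne ⟨hp, hp'⟩
      simp only at hne hp hp' ⊢
      have hp1 := (hsub i hp)
      have hp1' := (hsub i hp')
      have hw : 0 < p.1 * (1 - p.1) := mul_pos hp1.1.1 (sub_pos.2 hp1.1.2)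
      have h1 := (norm_sph_sub_sph_sq_mul_le hp1.1 hp1'.1).trans (hdiam i p hp p' hp')
      have h2 : 0 < ‖sph p - sph p'‖ := by
        rw [norm_pos_iff, sub_ne_zero]
        exact fun h => hne (congrArg Prod.fst (injOn_sph hp1 hp1' h))
      refine le_trans (le_of_eq ?_) (one_div_mul_rpow_le hs0 h2 ((le_div_iff₀ hw).2 h1))
      rw [Real.div_rpow (by positivity) hw.le, neg_div, Real.rpow_neg hw.le, div_inv_eq_mul])
  refine ⟨fun i => sph (ω i), fun i => norm_sph (hsub i (hω i)).1.1.le (hsub i (hω i)).1.2.le,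
    fun i j hij => ?_, ?_⟩
  · by_contra hne
    have := injOn_sph (hsub i (hω i)) (hsub j (hω j)) hij
    exact Set.disjoint_left.1 (hd hne) (hω i) (this ▸ hω j)
  · have h1 : 1 / s * rieszEnergy s (fun i => sph (ω i)) =
        ∑ i, ∑ j, if i = j then 0 else 1 / s * ‖sph (ω i) - sph (ω j)‖ ^ (-s) := by
      simp_rw [rieszEnergy, Finset.mul_sum]
      refine Finset.sum_congr rfl fun i _ => Finset.sum_congr rfl fun j _ => ?_
      split_ifs with h
      · subst h
        simp [Real.zero_rpow (neg_ne_zero.2 hs0)]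
      · rfl
    rw [h1]
    refine hle.trans (le_of_eq ?_)
    have h2 : ∫ p : ℝ × ℝ, (p.1 * (1 - p.1)) ^ (s / 2) ∂squareMeasure = I := by
      have := integral_fun_fst (μ := unitMeasure) (ν := unitMeasure)
        (fun a : ℝ => (a * (1 - a)) ^ (s / 2))
      rw [squareMeasure, this]
      simp [I]
    rw [integral_const_mul, integral_const_mul, integral_const_mul, integral_kernel hs2, h2,
      Fintype.card_fin, Real.div_rpow (by positivity) hN0.le, Real.rpow_add hN0, Real.rpow_one,
      neg_div, Real.rpow_neg hN0.le, div_inv_eq_mul]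
    ring

theorem exists_le_rieszEnergy {s : ℝ} (hs1 : -2 < s) (hs2 : s < 2) (hs0 : s ≠ 0) :
    ∃ K : ℝ, 0 < K ∧ ∀ N : ℕ, 1 ≤ N → ∀ q : Fin N → EuclideanSpace ℝ (Fin 3),
      (∀ i, ‖q i‖ = 1) → Function.Injective q →
      1 / s * (Wenergy s * (N : ℝ) ^ 2 - K * (N : ℝ) ^ (1 + s / 2)) ≤
        1 / s * rieszEnergy s q := by
  rcases lt_or_gt_of_ne hs0 with hs | hs
  · obtain ⟨K, hK, h⟩ := rieszEnergy_le_of_neg hs hs1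
    exact ⟨K, hK, fun N hN q hq _ =>
      mul_le_mul_of_nonpos_left (h N hN q hq) (one_div_neg.2 hs).le⟩
  · obtain ⟨K, hK, h⟩ := le_rieszEnergy_of_pos hs hs2
    exact ⟨K, hK, fun N hN q hq hinj =>
      mul_le_mul_of_nonneg_left (h N hN q hq hinj) (one_div_pos.2 hs).le⟩

theorem avgE_eq {s : ℝ} (hs : s ≠ 0) {N : ℕ} (hN : 2 ≤ N) (q : Fin N → EuclideanSpace ℝ (Fin 3)) :
    avgE s N q = 1 / s * rieszEnergy s q / (N * (N - 1)) - 1 / s := by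
  have hN0 : (2 : ℝ) ≤ N := by exact_mod_cast hN
  have hN1 : (N : ℝ) - 1 ≠ 0 := by linarith
  have hN2 : (N : ℝ) ≠ 0 := by linarith
  have h1 : ∀ i j, ‖q i - q j‖ ^ (-s) - 1 + (if i = j then 1 else 0) =
      s * (if i < j then Vpair s ‖q i - q j‖ else 0) +
      s * (if j < i then Vpair s ‖q j - q i‖ else 0) := by
    intro i j
    simp only [Vpair, if_neg hs]
    rcases lt_trichotomy i j with h | h | h
    · rw [if_neg h.ne, if_pos h, if_neg h.asymm]
      field_simp
      ring
    · subst h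
      simp [Real.zero_rpow (neg_ne_zero.2 hs)]
    · rw [if_neg h.ne', if_pos h, if_neg h.asymm, norm_sub_rev]
      field_simp
      ring
  have h2 : rieszEnergy s q - N * N + N =
      s * (2 * ∑ i : Fin N, ∑ j : Fin N, if i < j then Vpair s ‖q i - q j‖ else 0) := by
    calc rieszEnergy s q - N * N + N =
        ∑ i, ∑ j, (‖q i - q j‖ ^ (-s) - 1 + (if i = j then 1 else 0)) := by
          simp [rieszEnergy, Finset.sum_add_distrib, Finset.sum_sub_distrib]
      _ = _ := by
          simp_rw [h1, Finset.sum_add_distrib]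
          rw [Finset.sum_comm (f := fun i j =>
            s * (if j < i then Vpair s ‖q j - q i‖ else 0))]
          simp_rw [← Finset.mul_sum]
          ring
  rw [avgE]
  field_simp
  linear_combination -h2

theorem adjusted_energy_eq {s : ℝ} (hs : s ≠ 0) {N : ℕ} (hN : 2 ≤ N) (K : ℝ) :
    1 / s * (Wenergy s * (N : ℝ) ^ 2 - K * (N : ℝ) ^ (1 + s / 2)) / (N * (N - 1)) - 1 / s -
      (Wenergy s - 1) / s = 1 / s * (Wenergy s - K * (N : ℝ) ^ (s / 2)) / (N - 1) := by
  have hN0 : (2 : ℝ) ≤ N := by exact_mod_cast hN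
  have hN1 : (N : ℝ) - 1 ≠ 0 := by linarith
  have hN2 : (N : ℝ) ≠ 0 := by linarith
  rw [Real.rpow_add (by linarith), Real.rpow_one]
  field_simp
  ring

theorem exists_umin_bounds {s : ℝ} (hs1 : -2 < s) (hs2 : s < 2) (hs0 : s ≠ 0) :
    ∃ K K' : ℝ, 0 < K ∧ 0 < K' ∧ ∀ N : ℕ, 2 ≤ N →
      1 / s * (Wenergy s - K * (N : ℝ) ^ (s / 2)) / (N - 1) ≤ umin s N ∧
      umin s N ≤ 1 / s * (Wenergy s - K' * (N : ℝ) ^ (s / 2)) / (N - 1) := by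
  obtain ⟨K, hK, hlow⟩ := exists_le_rieszEnergy hs1 hs2 hs0
  obtain ⟨K', hK', hup⟩ := exists_rieszEnergy_le hs1 hs2 hs0
  refine ⟨K, K', hK, hK', fun N hN => ?_⟩
  have hN1 : 1 ≤ N := by omega
  have hN0 : (2 : ℝ) ≤ N := by exact_mod_cast hN
  have hpos : 0 < (N : ℝ) * (N - 1) := mul_pos (by linarith) (by linarith)
  obtain ⟨q, hq, hinj, hle⟩ := hup N hN1
  let S : Set ℝ := { E : ℝ | ∃ q : Fin N → EuclideanSpace ℝ (Fin 3),
    (∀ i, ‖q i‖ = 1) ∧ Function.Injective q ∧ E = avgE s N q }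
  have hmem : avgE s N q ∈ S := ⟨q, hq, hinj, rfl⟩
  have hlb : ∀ E ∈ S,
      1 / s * (Wenergy s * (N : ℝ) ^ 2 - K * (N : ℝ) ^ (1 + s / 2)) / (N * (N - 1)) - 1 / s ≤
        E := by
    rintro E ⟨q, hq, hinj, rfl⟩
    rw [avgE_eq hs0 hN]
    have := hlow N hN1 q hq hinj
    gcongr
  rw [← adjusted_energy_eq hs0 hN K, ← adjusted_energy_eq hs0 hN K', umin, vmin]
  constructor
  · exact sub_le_sub_right (le_csInf ⟨_, hmem⟩ hlb) _
  · have h := csInf_le ⟨_, hlb⟩ hmem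
    rw [avgE_eq hs0 hN] at h
    refine sub_le_sub_right (h.trans ?_) _
    gcongr

end RieszSphere

theorem stmt16 (s : ℝ) (hs1 : -2 < s) (hs2 : s < 2) (hs0 : s ≠ 0) :
    ∃ c C : ℝ, 0 < c ∧ c < C ∧ ∃ N₀ : ℕ, ∀ N : ℕ, N₀ ≤ N →
      ((s < 0 →
          (1 / s) * (Wenergy s - c * (N : ℝ) ^ (s / 2)) / ((N : ℝ) - 1) ≤ umin s N ∧
          umin s N ≤ (1 / s) * (Wenergy s - C * (N : ℝ) ^ (s / 2)) / ((N : ℝ) - 1)) ∧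
       (0 < s →
          (1 / s) * (Wenergy s - C * (N : ℝ) ^ (s / 2)) / ((N : ℝ) - 1) ≤ umin s N ∧
          umin s N ≤ (1 / s) * (Wenergy s - c * (N : ℝ) ^ (s / 2)) / ((N : ℝ) - 1))) := by
  obtain ⟨K, K', hK, hK', h⟩ := RieszSphere.exists_umin_bounds hs1 hs2 hs0
  have hN1 : ∀ N : ℕ, 2 ≤ N → 0 ≤ (N : ℝ) - 1 := fun N hN => by
    have : (2 : ℝ) ≤ N := by exact_mod_cast hN
    linarith
  rcases lt_or_gt_of_ne hs0 with hs | hs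
  · refine ⟨K, K + K', hK, by linarith, 2, fun N hN => ⟨fun _ => ⟨(h N hN).1, (h N hN).2.trans ?_⟩,
      fun hs' => absurd hs hs'.not_gt⟩⟩
    refine div_le_div_of_nonneg_right (mul_le_mul_of_nonpos_left ?_ (one_div_neg.2 hs).le) (hN1 N hN)
    gcongr
    linarith
  · refine ⟨K', K + K', hK', by linarith, 2, fun N hN => ⟨fun hs' => absurd hs hs'.not_gt,
      fun _ => ⟨le_trans ?_ (h N hN).1, (h N hN).2⟩⟩⟩
    refine div_le_div_of_nonneg_right (mul_le_mul_of_nonneg_left ?_ (one_div_pos.2 hs).le) (hN1 N hN)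
    gcongr
    linarith
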